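/- arXiv:1602.01085 — 3 statements merged into one kernel-verified Lean document; each statement's English description precedes it below -/
import Mathlib

section
/- Fix a positive integer m, fix x ∈ ℝ with 0 < x ≤ 1, and fix N ∈ ℕ with N ≥ m. Then, as q → 1⁻ (with q ∈ (0,1)), 𝓛_q(−m,x) = [m·ζ′(1−m,x) + (log log(1/q) − H_{m−1})·B_m(x)]·(log q)^(m−1)/m! − ∑_{k=0, k≠m}^{N} (ζ(1+m−k)/k!)·B_k(x)·(log q)^(k−1) + O((log(1/q))^N). -/
open Filter Topology Asymptotics Finset Real

/-- Euler-Maclaurin correction term. -/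
noncomputable def emA (F : ℕ → ℝ → ℂ) (r n : ℕ) : ℂ :=
  ∑ k ∈ Finset.range n, ∫ v in (0:ℝ)..1,
    (((bernoulliFun r v / (Nat.factorial r : ℝ) : ℝ)) : ℂ) * F r (k + v)

lemma em_cont (F : ℕ → ℝ → ℂ) (hF : ∀ r v, 0 ≤ v → HasDerivAt (F r) (F (r+1) v) v) (r k : ℕ) :
    ContinuousOn (fun v : ℝ => F r (k + v)) (Set.uIcc 0 1) := by
  intro v hv
  rw [Set.uIcc_of_le zero_le_one] at hv
  have h : ContinuousAt (F r) (k + v) := (hF r (k + v) (by have := hv.1; positivity)).continuousAt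
  exact (ContinuousAt.comp (f := fun v : ℝ => (k:ℝ) + v) h (by fun_prop)).continuousWithinAt

lemma em_deriv (r : ℕ) (v : ℝ) :
    HasDerivAt (fun v : ℝ => (((bernoulliFun (r+1) v / (Nat.factorial (r+1) : ℝ) : ℝ)) : ℂ))
      (((bernoulliFun r v / (Nat.factorial r : ℝ) : ℝ)) : ℂ) v := by
  have h := ((hasDerivAt_bernoulliFun (r+1) v).div_const ((Nat.factorial (r+1) : ℝ))).ofReal_comp
  convert h using 2
  rw [Nat.factorial_succ]
  have : (Nat.factorial r : ℝ) ≠ 0 := by positivity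
  push_cast
  field_simp
  try simp

lemma em_step (F : ℕ → ℝ → ℂ) (hF : ∀ r v, 0 ≤ v → HasDerivAt (F r) (F (r+1) v) v) (r n : ℕ) :
    emA F r n = (∑ k ∈ Finset.range n,
      ((((bernoulliFun (r+1) 1 / (Nat.factorial (r+1) : ℝ) : ℝ)) : ℂ) * F r (k + 1)
       - (((bernoulliFun (r+1) 0 / (Nat.factorial (r+1) : ℝ) : ℝ)) : ℂ) * F r k))
      - emA F (r+1) n := by
  unfold emA
  rw [← Finset.sum_sub_distrib]
  refine Finset.sum_congr rfl fun k _ => ?_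
  have h := intervalIntegral.integral_mul_deriv_eq_deriv_mul (a := (0:ℝ)) (b := 1)
    (u := fun v : ℝ => F r (k + v)) (u' := fun v : ℝ => F (r+1) (k + v))
    (v := fun v : ℝ => (((bernoulliFun (r+1) v / (Nat.factorial (r+1) : ℝ) : ℝ)) : ℂ))
    (v' := fun v : ℝ => (((bernoulliFun r v / (Nat.factorial r : ℝ) : ℝ)) : ℂ))
    (by
      intro v hv
      rw [Set.uIcc_of_le zero_le_one] at hv
      have h1 := hF r (k + v) (by have := hv.1; positivity)
      exact h1.comp_const_add (k:ℝ) v)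
    (fun v _ => em_deriv r v)
    ((em_cont F hF (r+1) k).intervalIntegrable)
    (by
      apply Continuous.intervalIntegrable
      have := continuous_bernoulliFun r
      fun_prop)
  simp only [add_zero] at h
  rw [intervalIntegral.integral_congr (g := fun v : ℝ => F r (k + v) * (((bernoulliFun r v / (Nat.factorial r : ℝ) : ℝ)) : ℂ)) (fun v _ => mul_comm _ _), h,
    intervalIntegral.integral_congr (g := fun v : ℝ => (((bernoulliFun (r+1) v / (Nat.factorial (r+1) : ℝ) : ℝ)) : ℂ) * F (r+1) (k + v)) (fun v _ => mul_comm _ _)]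
  ring

lemma zeta_bern (r : ℕ) : riemannZeta (-(r:ℂ)) / (Nat.factorial r : ℂ) =
    (-1)^r * (((bernoulliFun (r+1) 0 / (Nat.factorial (r+1) : ℝ) : ℝ)) : ℂ) := by
  rw [riemannZeta_neg_nat_eq_bernoulli, bernoulliFun_eval_zero, Nat.factorial_succ]
  have : (Nat.factorial r : ℂ) ≠ 0 := by exact_mod_cast (Nat.factorial_pos r).ne'
  have h2 : (r : ℂ) + 1 ≠ 0 := by exact_mod_cast Nat.succ_ne_zero r
  push_cast
  field_simp

lemma em_fin (F : ℕ → ℝ → ℂ) (hF : ∀ r v, 0 ≤ v → HasDerivAt (F r) (F (r+1) v) v) (M n : ℕ) :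
    ∑ k ∈ Finset.range n, F 0 (k + 1) = (∫ v in (0:ℝ)..n, F 0 v)
      + ∑ r ∈ Finset.range (M+1), riemannZeta (-(r:ℂ)) / (Nat.factorial r : ℂ) * (F r 0 - F r n)
      + (-1)^M * emA F (M+1) n := by
  induction M with
  | zero =>
    have h0 : emA F 0 n = ∫ v in (0:ℝ)..n, F 0 v := by
      unfold emA
      have := intervalIntegral.sum_integral_adjacent_intervals (f := F 0) (μ := MeasureTheory.volume)
        (a := fun k : ℕ => (k:ℝ)) (n := n) (by
          intro k _
          apply ContinuousOn.intervalIntegrable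
          intro v hv
          rw [Set.uIcc_of_le (by push_cast; linarith)] at hv
          exact (hF 0 v (le_trans (by positivity) hv.1)).continuousAt.continuousWithinAt)
      simp only [Nat.cast_zero] at this
      rw [← this]
      refine Finset.sum_congr rfl fun k _ => ?_
      simp
    have h := em_step F hF 0 n
    rw [h0] at h
    rw [h, zero_add, Finset.sum_range_one, zeta_bern]
    have h3 : F 0 0 - F 0 n = - ∑ k ∈ Finset.range n, (F 0 (k+1) - F 0 k) := by
      have := Finset.sum_range_sub (fun k : ℕ => F 0 k) n
      push_cast at this
      rw [this]; ring
    rw [h3]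
    simp only [bernoulliFun_one, zero_add, Nat.factorial_one, pow_zero]
    rw [mul_neg, Finset.mul_sum, one_mul (emA _ _ _), sub_add_eq_add_sub, sub_add_cancel, ← Finset.sum_neg_distrib,
      ← Finset.sum_add_distrib]
    refine Finset.sum_congr rfl fun k _ => ?_
    push_cast
    ring
  | succ M ih =>
    rw [ih, em_step F hF (M+1) n, Finset.sum_range_succ _ (M+1), zeta_bern (M+1),
      bernoulliFun_endpoints_eq_of_ne_one (by omega)]
    have h3 := Finset.sum_range_sub (fun k : ℕ => F (M+1) k) n
    push_cast at h3
    simp_rw [← mul_sub]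
    rw [← Finset.mul_sum, h3]
    ring

lemma em_bound (M : ℕ) : ∃ C : ℝ, 0 ≤ C ∧ ∀ F : ℕ → ℝ → ℂ,
    (∀ r v, 0 ≤ v → HasDerivAt (F r) (F (r+1) v) v) →
    (∀ r, MeasureTheory.IntegrableOn (F r) (Set.Ioi 0)) →
    (∀ r, Tendsto (fun k : ℕ => F r k) atTop (𝓝 0)) →
    (Summable (fun k : ℕ => F 0 (k+1))) →
    ‖(∑' k : ℕ, F 0 (k+1)) - (∫ v in Set.Ioi (0:ℝ), F 0 v)
      - ∑ r ∈ Finset.range (M+1), riemannZeta (-(r:ℂ)) / (Nat.factorial r : ℂ) * F r 0‖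
      ≤ C * ∫ v in Set.Ioi (0:ℝ), ‖F (M+1) v‖ := by
  obtain ⟨C, hC⟩ := (isCompact_Icc (a := (0:ℝ)) (b := 1)).exists_bound_of_continuousOn
    (f := fun v : ℝ => (((bernoulliFun (M+1) v / (Nat.factorial (M+1) : ℝ) : ℝ)) : ℂ)) (by
      have := continuous_bernoulliFun (M+1)
      fun_prop)
  have hC0 : 0 ≤ C := le_trans (norm_nonneg _) (hC 0 (by simp))
  refine ⟨C, hC0, fun F hF hI hT hS => ?_⟩
  have hA : ∀ n, ‖emA F (M+1) n‖ ≤ C * ∫ v in Set.Ioi (0:ℝ), ‖F (M+1) v‖ := by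
    intro n
    have h1 : ‖emA F (M+1) n‖ ≤ ∑ k ∈ Finset.range n, C * ∫ v in (k:ℝ)..((k+1:ℕ):ℝ), ‖F (M+1) v‖ := by
      unfold emA
      refine (norm_sum_le _ _).trans (Finset.sum_le_sum fun k _ => ?_)
      have h2 : ∫ v in (k:ℝ)..((k+1:ℕ):ℝ), ‖F (M+1) v‖ = ∫ v in (0:ℝ)..1, ‖F (M+1) (k+v)‖ := by
        rw [intervalIntegral.integral_comp_add_left (fun v => ‖F (M+1) v‖)]
        simp
      rw [h2, ← intervalIntegral.integral_const_mul]
      refine intervalIntegral.norm_integral_le_of_norm_le zero_le_one ?_ ?_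
      · refine Filter.Eventually.of_forall fun v hv => ?_
        rw [norm_mul]
        exact mul_le_mul_of_nonneg_right (hC v ⟨hv.1.le, hv.2⟩) (norm_nonneg _)
      · exact ((em_cont F hF (M+1) k).norm.intervalIntegrable).const_mul C
    refine h1.trans ?_
    rw [← Finset.mul_sum]
    refine mul_le_mul_of_nonneg_left ?_ hC0
    have := intervalIntegral.sum_integral_adjacent_intervals (f := fun v => ‖F (M+1) v‖) (μ := MeasureTheory.volume)
        (a := fun k : ℕ => (k:ℝ)) (n := n) (by
          intro k _
          apply ContinuousOn.intervalIntegrable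
          intro v hv
          rw [Set.uIcc_of_le (by push_cast; linarith)] at hv
          exact (hF (M+1) v (le_trans (by positivity) hv.1)).continuousAt.norm.continuousWithinAt)
    rw [this, Nat.cast_zero, intervalIntegral.integral_of_le (by positivity)]
    exact MeasureTheory.setIntegral_mono_set (hI (M+1)).norm
      (Filter.Eventually.of_forall fun _ => norm_nonneg _)
      (Filter.Eventually.of_forall fun v hv => hv.1)
  have hlim : Tendsto (fun n : ℕ => (∑ k ∈ Finset.range n, F 0 (k + 1)) - (∫ v in (0:ℝ)..n, F 0 v)
      - ∑ r ∈ Finset.range (M+1), riemannZeta (-(r:ℂ)) / (Nat.factorial r : ℂ) * (F r 0 - F r n)) atTop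
      (𝓝 ((∑' k : ℕ, F 0 (k+1)) - (∫ v in Set.Ioi (0:ℝ), F 0 v)
      - ∑ r ∈ Finset.range (M+1), riemannZeta (-(r:ℂ)) / (Nat.factorial r : ℂ) * (F r 0 - 0))) := by
    refine (hS.hasSum.tendsto_sum_nat.sub ?_).sub ?_
    · exact MeasureTheory.intervalIntegral_tendsto_integral_Ioi 0 (hI 0) tendsto_natCast_atTop_atTop
    · exact tendsto_finsetSum _ fun r _ => (tendsto_const_nhds.sub (hT r)).const_mul _
  simp only [sub_zero] at hlim
  refine le_of_tendsto hlim.norm (Filter.Eventually.of_forall fun n => ?_)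
  rw [em_fin F hF M n]
  have : ∀ a b c : ℂ, a + b + c - a - b = c := by intros; ring
  rw [this, norm_mul, norm_pow, norm_neg, norm_one, one_pow, one_mul]
  exact hA n

lemma em_scaled (Ψ : ℕ → ℝ → ℂ) (K : ℕ → ℝ)
    (hΨ : ∀ r v, 0 ≤ v → HasDerivAt (Ψ r) (Ψ (r+1) v) v)
    (hK : ∀ r v, 0 ≤ v → ‖Ψ r v‖ ≤ K r * (1 + v^2)⁻¹) (M : ℕ) :
    ∃ C : ℝ, ∀ t : ℝ, 0 < t → Summable (fun k : ℕ => Ψ 0 (t * (k+1))) ∧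
    ‖(∑' k : ℕ, Ψ 0 (t * (k+1))) - (t:ℂ)⁻¹ * (∫ v in Set.Ioi (0:ℝ), Ψ 0 v)
      - ∑ r ∈ Finset.range (M+1), riemannZeta (-(r:ℂ)) / (Nat.factorial r : ℂ) * ((t:ℂ)^r * Ψ r 0)‖
      ≤ C * t^M := by
  obtain ⟨C, hC0, hC⟩ := em_bound M
  refine ⟨C * ∫ v in Set.Ioi (0:ℝ), ‖Ψ (M+1) v‖, fun t ht => ?_⟩
  have hIΨ : ∀ r, MeasureTheory.IntegrableOn (Ψ r) (Set.Ioi 0) := by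
    intro r
    refine MeasureTheory.Integrable.mono' ((integrable_inv_one_add_sq.const_mul (K r)).integrableOn) ?_ ?_
    · apply ContinuousOn.aestronglyMeasurable _ measurableSet_Ioi
      intro v hv
      exact (hΨ r v (le_of_lt hv)).continuousAt.continuousWithinAt
    · refine (MeasureTheory.ae_restrict_mem measurableSet_Ioi).mono fun v hv => ?_
      exact hK r v (le_of_lt hv)
  have hK0 : ∀ r, 0 ≤ K r := by
    intro r
    have := (norm_nonneg _).trans (hK r 0 le_rfl)
    simpa using this
  have hb : ∀ r, ∀ v : ℝ, 0 < v → ‖Ψ r (t*v)‖ ≤ K r * (t^2)⁻¹ * (v^2)⁻¹ := by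
    intro r v hv
    refine (hK r (t*v) (by positivity)).trans ?_
    rw [mul_assoc, ← mul_inv, ← mul_pow]
    refine mul_le_mul_of_nonneg_left ?_ (hK0 r)
    apply inv_anti₀ (by positivity)
    linarith
  have hsum : Summable (fun k : ℕ => Ψ 0 (t * (k+1))) := by
    have h1 : Summable (fun k : ℕ => K 0 * (t^2)⁻¹ * (((k:ℝ)+1)^2)⁻¹) := by
      apply Summable.mul_left
      have := (summable_nat_add_iff 1).2 (Real.summable_nat_pow_inv.2 (show 1 < 2 by norm_num))
      simpa using this
    exact Summable.of_norm_bounded h1 fun k => hb 0 (k+1) (by positivity)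
  refine ⟨hsum, ?_⟩
  have := hC (fun r v => (t:ℂ)^r * Ψ r (t*v)) ?_ ?_ ?_ ?_
  · simp only [pow_zero, one_mul, mul_zero] at this
    have e1 : ∫ v in Set.Ioi (0:ℝ), Ψ 0 (t*v) = (t:ℂ)⁻¹ * ∫ v in Set.Ioi (0:ℝ), Ψ 0 v := by
      rw [MeasureTheory.integral_comp_mul_left_Ioi (Ψ 0) 0 ht, mul_zero]
      simp
    have e2 : ∫ v in Set.Ioi (0:ℝ), ‖(t:ℂ)^(M+1) * Ψ (M+1) (t*v)‖ =
        t^M * ∫ v in Set.Ioi (0:ℝ), ‖Ψ (M+1) v‖ := by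
      simp_rw [norm_mul, norm_pow, Complex.norm_real, Real.norm_of_nonneg ht.le]
      rw [MeasureTheory.integral_const_mul,
        MeasureTheory.integral_comp_mul_left_Ioi (fun v => ‖Ψ (M+1) v‖) 0 ht, mul_zero, smul_eq_mul]
      field_simp
      ring
    rw [e1, e2] at this
    refine this.trans (le_of_eq (by ring))
  · intro r v hv
    have h1 := hΨ r (t*v) (by positivity)
    have h2 : HasDerivAt (fun v : ℝ => t * v) t v := by simpa using (hasDerivAt_id v).const_mul t
    have h3 := (h1.scomp v h2).const_mul ((t:ℂ)^r)
    have h4 : (t:ℂ)^(r+1) * Ψ (r+1) (t*v) = (t:ℂ)^r * t • Ψ (r+1) (t*v) := by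
      rw [Complex.real_smul]; ring
    simp only [h4]
    exact h3
  · intro r
    apply MeasureTheory.Integrable.const_mul
    exact (MeasureTheory.integrableOn_Ioi_comp_mul_left_iff (Ψ r) 0 ht).2 (by simpa using hIΨ r)
  · intro r
    rw [← mul_zero ((t:ℂ)^r)]
    apply Tendsto.const_mul
    have h1 : Tendsto (fun k : ℕ => K r * (t^2)⁻¹ * ((k:ℝ)^2)⁻¹) atTop (𝓝 0) := by
      rw [← mul_zero (K r * (t^2)⁻¹)]
      apply Tendsto.const_mul
      apply Tendsto.inv_tendsto_atTop
      exact (tendsto_pow_atTop (by norm_num)).comp tendsto_natCast_atTop_atTop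
    refine squeeze_zero_norm' ?_ h1
    filter_upwards [eventually_gt_atTop 0] with k hk
    exact hb r k (by exact_mod_cast hk)
  · simpa using hsum

/-- iterated difference quotient at `0` -/
noncomputable def tl (f : ℂ → ℂ) (k : ℕ) : ℂ → ℂ := (Function.swap dslope 0)^[k] f

lemma tl_zero (f : ℂ → ℂ) : tl f 0 = f := rfl

lemma tl_add (f : ℂ → ℂ) (j k : ℕ) : tl (tl f j) k = tl f (j + k) := by
  unfold tl
  rw [add_comm, Function.iterate_add_apply]

lemma tl_succ (f : ℂ → ℂ) (k : ℕ) : tl f (k+1) = dslope (tl f k) 0 := by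
  rw [← tl_add]; rfl

lemma tl_expand (f : ℂ → ℂ) (k : ℕ) (z : ℂ) :
    f z = ∑ j ∈ Finset.range k, tl f j 0 * z^j + z^k * tl f k z := by
  induction k with
  | zero => simp [tl_zero]
  | succ k ih =>
    rw [Finset.sum_range_succ, tl_succ]
    have h := sub_smul_dslope (tl f k) 0 z
    simp only [sub_zero, smul_eq_mul] at h
    rw [pow_succ, mul_assoc, h]
    conv_lhs => rw [ih]
    ring

lemma tl_diff (f : ℂ → ℂ) (S : Set ℂ) (hS : S ∈ 𝓝 (0:ℂ)) (hf : DifferentiableOn ℂ f S) (k : ℕ) :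
    DifferentiableOn ℂ (tl f k) S := by
  induction k with
  | zero => exact hf
  | succ k ih =>
    rw [tl_succ]
    exact (Complex.differentiableOn_dslope hS).2 ih

lemma iteratedDeriv_eq_tl (f : ℂ → ℂ) (hf : AnalyticAt ℂ f 0) (r : ℕ) :
    iteratedDeriv r f 0 = (Nat.factorial r : ℂ) * tl f r 0 := by
  have h := hf.hasFPowerSeriesAt
  have h2 := (h.has_fpower_series_iterate_dslope_fslope r).coeff_zero 1
  have h3 : tl f r 0 = iteratedDeriv r f 0 / (Nat.factorial r : ℂ) := by
    unfold tl
    rw [← h2]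
    have := FormalMultilinearSeries.coeff_iterate_fslope r 0 (p := FormalMultilinearSeries.ofScalars ℂ (fun n ↦ iteratedDeriv n f 0 / (Nat.factorial n : ℂ)))
    rw [zero_add, FormalMultilinearSeries.coeff_ofScalars] at this
    exact this
  have : (Nat.factorial r : ℂ) ≠ 0 := by exact_mod_cast (Nat.factorial_pos r).ne'
  rw [h3]; field_simp

lemma dslope_mul_self (h : ℂ → ℂ) (hh : ContinuousAt h 0) : dslope (fun z => z * h z) 0 = h := by
  funext z
  by_cases hz : z = 0
  · subst hz
    rw [dslope_same]
    have : HasDerivAt (fun z => z * h z) (h 0) 0 := by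
      rw [hasDerivAt_iff_tendsto_slope]
      refine (hh.tendsto.mono_left nhdsWithin_le_nhds).congr' ?_
      filter_upwards [self_mem_nhdsWithin] with w hw
      rw [slope_def_field]
      simp only [zero_mul, sub_zero]
      rw [mul_div_cancel_left₀ _ hw]
    exact this.deriv
  · rw [dslope_of_ne _ hz, slope_def_field]
    simp only [zero_mul, sub_zero]
    rw [mul_div_cancel_left₀ _ hz]

lemma tl_mul_self (h : ℂ → ℂ) (hh : ContinuousAt h 0) (n : ℕ) :
    tl (fun z => z * h z) (n+1) = tl h n := by
  rw [add_comm, ← tl_add]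
  congr 1
  exact dslope_mul_self h hh

/-- the function `1 - exp (-z)` -/
noncomputable def lamE (z : ℂ) : ℂ := 1 - Complex.exp (-z)
noncomputable def lamD : ℂ → ℂ := tl lamE 1
noncomputable def lamG (x : ℝ) (z : ℂ) : ℂ := Complex.exp (-(x*z)) / lamD z
def lamS : Set ℂ := {z | |z.im| < 2}

lemma lamS_open : IsOpen lamS := by
  unfold lamS
  exact isOpen_lt (by fun_prop) continuous_const

lemma lamS_zero : lamS ∈ 𝓝 (0:ℂ) := lamS_open.mem_nhds (by simp [lamS])

lemma lamE_eq (z : ℂ) : lamE z = z * lamD z := by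
  have := tl_expand lamE 1 z
  rw [this]
  simp [tl_zero, lamE, lamD]

lemma lamE_diff : Differentiable ℂ lamE := by unfold lamE; fun_prop

lemma lamD_diff : Differentiable ℂ lamD := by
  rw [← differentiableOn_univ]
  exact tl_diff _ _ univ_mem lamE_diff.differentiableOn 1

lemma lamE_iter (r : ℕ) : iteratedDeriv (r+1) lamE 0 = (-1)^r := by
  rw [iteratedDeriv_succ']
  have h1 : deriv lamE = fun z => Complex.exp (-z) := by
    funext z
    have : HasDerivAt lamE (Complex.exp (-z)) z := by
      unfold lamE
      have := ((hasDerivAt_neg z).cexp).const_sub 1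
      simpa using this
    exact this.deriv
  rw [h1]
  have := iteratedDeriv_cexp_const_mul r (-1)
  simp at this
  rw [this]; simp

lemma lamD_zero : lamD 0 = 1 := by
  have := iteratedDeriv_eq_tl lamE (lamE_diff.analyticAt 0) 1
  have h2 := lamE_iter 0
  simp only [zero_add, pow_zero] at h2
  unfold lamD
  rw [h2] at this
  simpa using this.symm

lemma lamE_ne {z : ℂ} (hz : z ∈ lamS) (h0 : z ≠ 0) : lamE z ≠ 0 := by
  intro h
  unfold lamE at h
  have h1 : Complex.exp (-z) = 1 := (sub_eq_zero.1 h).symm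
  rw [Complex.exp_eq_one_iff] at h1
  obtain ⟨n, hn⟩ := h1
  have him := congrArg Complex.im hn
  simp at him
  have hz' : |z.im| < 2 := hz
  have hn0 : n = 0 := by
    by_contra hne
    have : (1:ℝ) ≤ |(n:ℝ)| := by exact_mod_cast Int.one_le_abs hne
    have h3 : |z.im| = |(n:ℝ)| * (2 * π) := by
      rw [← abs_neg, him, abs_mul, abs_of_pos (by positivity : 0 < 2 * π)]
    nlinarith [Real.pi_gt_three]
  rw [hn0] at hn
  simp at hn
  exact h0 hn

lemma lamD_ne {z : ℂ} (hz : z ∈ lamS) : lamD z ≠ 0 := by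
  by_cases h0 : z = 0
  · rw [h0, lamD_zero]; exact one_ne_zero
  · intro h
    apply lamE_ne hz h0
    rw [lamE_eq, h, mul_zero]

lemma lamG_diff (x : ℝ) : DifferentiableOn ℂ (lamG x) lamS := by
  unfold lamG
  refine DifferentiableOn.div (by fun_prop) lamD_diff.differentiableOn fun z hz => lamD_ne hz

lemma lamG_an (x : ℝ) : AnalyticAt ℂ (lamG x) 0 :=
  (lamG_diff x).analyticAt lamS_zero

lemma lamG_mul (x : ℝ) {z : ℂ} (hz : z ∈ lamS) : lamG x z * lamE z = z * Complex.exp (-(x*z)) := by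
  unfold lamG
  rw [lamE_eq]
  have := lamD_ne hz
  field_simp

/-- Taylor coefficients of `lamG`. -/
noncomputable def lamc (x : ℝ) (k : ℕ) : ℂ :=
  (-1)^k * ((bernoulliFun k x : ℝ) : ℂ) / (Nat.factorial k : ℂ)

lemma bern_rec (x : ℝ) (n : ℕ) :
    ∑ k ∈ Finset.range (n+1), ((n+1).choose k : ℂ) * ((bernoulliFun k x : ℝ) : ℂ) = (n+1) * (x:ℂ)^n := by
  have h := congrArg (fun p : Polynomial ℚ => (Polynomial.map (algebraMap ℚ ℝ) p).eval x) (Polynomial.sum_bernoulli n)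
  simp only [Polynomial.map_sum, Polynomial.eval_finsetSum, Polynomial.map_smul, Polynomial.eval_smul,
    Polynomial.map_monomial, Polynomial.eval_monomial] at h
  have h2 : ∑ k ∈ Finset.range (n+1), ((n+1).choose k : ℝ) * bernoulliFun k x = (n+1) * x^n := by
    simpa [bernoulliFun] using h
  exact_mod_cast h2

lemma lamG_iter (x : ℝ) (k : ℕ) : iteratedDeriv k (lamG x) 0 = (-1)^k * ((bernoulliFun k x : ℝ) : ℂ) := by
  induction k using Nat.strong_induction_on with
  | _ n ih =>
  have h1 : iteratedDeriv (n+1) (lamG x * lamE) 0 = (n+1) * (-(x:ℂ))^n := by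
    have e : (lamG x * lamE) =ᶠ[𝓝 0] fun z => z * Complex.exp (-(x*z)) := by
      filter_upwards [lamS_zero] with z hz using lamG_mul x hz
    rw [e.iteratedDeriv_eq]
    rw [iteratedDeriv_eq_tl _ (by fun_prop), tl_mul_self _ (by fun_prop), Nat.factorial_succ]
    have h2 := iteratedDeriv_eq_tl (fun z : ℂ => Complex.exp (-(x*z))) (by fun_prop) n
    have h3 := iteratedDeriv_cexp_const_mul n (-(x:ℂ))
    simp only [neg_mul] at h3
    rw [h3] at h2
    simp at h2
    push_cast
    rw [mul_assoc, ← h2]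
  rw [iteratedDeriv_mul (lamG_an x).contDiffAt (lamE_diff.analyticAt 0).contDiffAt, Finset.sum_range_succ,
    Finset.sum_range_succ] at h1
  simp only [Nat.sub_self, iteratedDeriv_zero] at h1
  have hE0 : lamE 0 = 0 := by simp [lamE]
  rw [hE0, mul_zero, add_zero, Nat.add_sub_cancel_left] at h1
  have hb := bern_rec x n
  rw [Finset.sum_range_succ] at hb
  have h4 : ∑ i ∈ Finset.range n, ((n+1).choose i : ℂ) * iteratedDeriv i (lamG x) 0 * iteratedDeriv (n+1-i) lamE 0
      = (-1)^n * ∑ i ∈ Finset.range n, ((n+1).choose i : ℂ) * ((bernoulliFun i x : ℝ) : ℂ) := by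
    rw [Finset.mul_sum]
    refine Finset.sum_congr rfl fun i hi => ?_
    have hi' := Finset.mem_range.1 hi
    rw [ih i hi', show n + 1 - i = (n - i) + 1 by omega, lamE_iter]
    have : (-1:ℂ)^n = (-1)^i * (-1)^(n-i) := by rw [← pow_add]; congr 1; omega
    rw [this]; ring
  have hE1 := lamE_iter 0
  simp only [zero_add, pow_zero] at hE1
  rw [h4, hE1] at h1
  have hch : ((n+1).choose n : ℂ) ≠ 0 := by
    rw [Nat.choose_succ_self_right]; exact_mod_cast Nat.succ_ne_zero n
  apply mul_left_cancel₀ hch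
  have hsq : ((-1:ℂ)^n) * (-1)^n = 1 := by rw [← mul_pow]; simp
  have : (-(x:ℂ))^n = (-1)^n * (x:ℂ)^n := by rw [← mul_pow]; simp
  rw [this] at h1
  linear_combination h1 - (-1)^n * hb

lemma lamG_coef (x : ℝ) (k : ℕ) : tl (lamG x) k 0 = lamc x k := by
  have h := iteratedDeriv_eq_tl _ (lamG_an x) k
  rw [lamG_iter] at h
  unfold lamc
  have : (Nat.factorial k : ℂ) ≠ 0 := by exact_mod_cast (Nat.factorial_pos k).ne'
  rw [h]; field_simp

lemma lamE_coef (r : ℕ) : tl lamE (r+1) 0 = (-1)^r / (Nat.factorial (r+1) : ℂ) := by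
  have h := iteratedDeriv_eq_tl _ (lamE_diff.analyticAt 0) (r+1)
  rw [lamE_iter] at h
  have : (Nat.factorial (r+1) : ℂ) ≠ 0 := by exact_mod_cast (Nat.factorial_pos (r+1)).ne'
  rw [h]; field_simp

/-- the regular part -/
noncomputable def lamψ (x : ℝ) (m : ℕ) (z : ℂ) : ℂ := tl (lamG x) (m+1) z + lamc x m * lamD z

lemma lamψ_diff (x : ℝ) (m : ℕ) : DifferentiableOn ℂ (lamψ x m) lamS :=
  (tl_diff _ _ lamS_zero (lamG_diff x) _).add (lamD_diff.differentiableOn.const_mul _)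

lemma lamψ_eq (x : ℝ) (m : ℕ) (z : ℂ) :
    lamG x z = ∑ j ∈ Finset.range m, lamc x j * z^j + lamc x m * z^m * Complex.exp (-z)
      + z^(m+1) * lamψ x m z := by
  have h := tl_expand (lamG x) (m+1) z
  rw [Finset.sum_range_succ] at h
  simp only [lamG_coef] at h
  rw [h]
  unfold lamψ
  have h2 := lamE_eq z
  unfold lamE at h2
  linear_combination (lamc x m * z^m) * h2

lemma lamψ_iter (x : ℝ) (m r : ℕ) : iteratedDeriv r (lamψ x m) 0 =
    (Nat.factorial r : ℂ) * (lamc x (m+1+r) + lamc x m * ((-1)^r / (Nat.factorial (r+1) : ℂ))) := by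
  have a1 : AnalyticAt ℂ (tl (lamG x) (m+1)) 0 :=
    (tl_diff _ _ lamS_zero (lamG_diff x) _).analyticAt lamS_zero
  have a2 : AnalyticAt ℂ lamD 0 := lamD_diff.analyticAt 0
  have e : lamψ x m = (tl (lamG x) (m+1)) + (lamc x m * lamD ·) := rfl
  rw [e, iteratedDeriv_add a1.contDiffAt (contDiffAt_const.mul a2.contDiffAt), iteratedDeriv_const_mul_field,
    iteratedDeriv_eq_tl _ a1, iteratedDeriv_eq_tl _ a2, tl_add, lamG_coef]
  unfold lamD
  rw [tl_add, add_comm 1 r, lamE_coef]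
  ring

lemma lamG_norm (x : ℝ) {z : ℂ} (hz : z ∈ lamS) (hre : 1 ≤ z.re) :
    ‖lamG x z‖ ≤ ‖z‖ * (2 * Real.exp (-(x * z.re))) := by
  have hz0 : z ≠ 0 := by rintro rfl; simp at hre; linarith
  have h := lamG_mul x hz
  have h1 : lamG x z = z * Complex.exp (-(x*z)) / lamE z := by
    rw [← h]; field_simp [lamE_ne hz hz0]
  have h2 : (1:ℝ)/2 ≤ ‖lamE z‖ := by
    unfold lamE
    have h3 : ‖Complex.exp (-z)‖ ≤ 1/2 := by
      rw [Complex.norm_exp]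
      have : Real.exp (-1) < 1/2 := by
        have := Real.exp_one_gt_d9
        rw [Real.exp_neg, one_div]
        exact inv_strictAnti₀ (by norm_num) (by linarith)
      refine le_trans (Real.exp_le_exp.2 ?_) this.le
      simp; linarith
    have h4 := norm_sub_norm_le (1:ℂ) (Complex.exp (-z))
    rw [norm_one] at h4
    linarith
  rw [h1, norm_div, norm_mul, Complex.norm_exp]
  have e : (-((x:ℂ)*z)).re = -(x * z.re) := by simp
  rw [e, div_le_iff₀ (by linarith)]
  have : 0 ≤ ‖z‖ * Real.exp (-(x * z.re)) := by positivity
  nlinarith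

lemma lamψ_bound (x : ℝ) (hx : 0 < x) (m : ℕ) (hm : 1 ≤ m) : ∃ C : ℝ, ∀ z : ℂ, -(1/2) ≤ z.re → |z.im| ≤ 1/2 →
    ‖lamψ x m z‖ ≤ C * ((1 + z.re)^2)⁻¹ := by
  have hcont : ContinuousOn (lamψ x m) lamS := (lamψ_diff x m).continuousOn
  have hcomp : IsCompact ((Set.Icc (-(1/2):ℝ) 1) ×ℂ (Set.Icc (-(1/2):ℝ) (1/2))) :=
    isCompact_Icc.reProdIm isCompact_Icc
  obtain ⟨C1, hC1⟩ := hcomp.exists_bound_of_continuousOn (f := lamψ x m) (hcont.mono (by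
    intro z hz
    rw [Complex.mem_reProdIm] at hz
    show |z.im| < 2
    rw [abs_lt]
    constructor <;> linarith [hz.2.1, hz.2.2]))
  set C2 : ℝ := 4 / x + ∑ j ∈ Finset.range m, ‖lamc x j‖ + ‖lamc x m‖ * 2 with hC2
  have hC2p : 0 ≤ C2 := by positivity
  have hC1p : 0 ≤ C1 := (norm_nonneg _).trans (hC1 0 (by rw [Complex.mem_reProdIm]; norm_num))
  refine ⟨4 * (C1 + C2), fun z hre him => ?_⟩
  have hzS : z ∈ lamS := by show |z.im| < 2; linarith
  rw [← div_eq_mul_inv, le_div_iff₀ (by have : 0 < 1 + z.re := by linarith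
                                        positivity)]
  rcases le_or_gt z.re 1 with h1 | h1
  · have h2 := hC1 z (by
      rw [Complex.mem_reProdIm]; exact ⟨⟨hre, h1⟩, abs_le.1 him⟩)
    have h3 : (1 + z.re)^2 ≤ 4 := by nlinarith
    nlinarith [norm_nonneg (lamψ x m z), sq_nonneg (1 + z.re)]
  · have hz0 : z ≠ 0 := by rintro rfl; simp at h1; linarith
    have hzn : z.re ≤ ‖z‖ := Complex.re_le_norm z
    have hzn2 : ‖z‖ ≤ 2 * z.re := by
      have := Complex.norm_le_abs_re_add_abs_im z
      rw [abs_of_pos (by linarith : 0 < z.re)] at this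
      linarith
    have hz1 : 1 ≤ ‖z‖ := by linarith
    have key : ‖lamψ x m z‖ * ‖z‖^2 ≤ C2 := by
      have he : z^(m+1) * lamψ x m z = lamG x z - ∑ j ∈ Finset.range m, lamc x j * z^j
          - lamc x m * z^m * Complex.exp (-z) := by rw [lamψ_eq x m z]; ring
      have hn : ‖z‖^(m+1) * ‖lamψ x m z‖ ≤ ‖z‖^(m-1) * C2 := by
        rw [← norm_pow, ← norm_mul, he]
        refine (norm_sub_le _ _).trans ?_
        have b1 := lamG_norm x hzS h1.le
        have ex : ∀ y : ℝ, 0 < y → z.re * Real.exp (-(y * z.re)) ≤ 1 / y := by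
          intro y hy
          have := Real.add_one_le_exp (y * z.re)
          rw [Real.exp_neg, ← div_eq_mul_inv, div_le_div_iff₀ (Real.exp_pos _) hy]
          linarith
        have p1 : 1 ≤ ‖z‖^(m-1) := one_le_pow₀ hz1
        have b1' : ‖lamG x z‖ ≤ ‖z‖^(m-1) * (4 / x) := by
          have h5 := ex x hx
          have h6 : ‖z‖ * (2 * Real.exp (-(x * z.re))) ≤ 4 / x := by
            calc ‖z‖ * (2 * Real.exp (-(x * z.re))) ≤ (2 * z.re) * (2 * Real.exp (-(x * z.re))) := by gcongr
              _ = 4 * (z.re * Real.exp (-(x * z.re))) := by ring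
              _ ≤ 4 * (1/x) := by gcongr
              _ = 4 / x := by ring
          have : 0 ≤ 4 / x := by positivity
          nlinarith
        have b2 : ‖∑ j ∈ Finset.range m, lamc x j * z^j‖ ≤ ‖z‖^(m-1) * ∑ j ∈ Finset.range m, ‖lamc x j‖ := by
          refine (norm_sum_le _ _).trans ?_
          rw [Finset.mul_sum]
          refine Finset.sum_le_sum fun j hj => ?_
          rw [norm_mul, norm_pow, mul_comm]
          refine mul_le_mul_of_nonneg_right ?_ (norm_nonneg _)
          exact pow_le_pow_right₀ hz1 (by have := Finset.mem_range.1 hj; omega)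
        have b3 : ‖lamc x m * z^m * Complex.exp (-z)‖ ≤ ‖z‖^(m-1) * (‖lamc x m‖ * 2) := by
          rw [norm_mul, norm_mul, norm_pow, Complex.norm_exp, Complex.neg_re]
          have h5 := ex 1 one_pos
          rw [one_mul, div_one] at h5
          have h6 : ‖z‖ * Real.exp (-z.re) ≤ 2 := by
            calc ‖z‖ * Real.exp (-z.re) ≤ (2 * z.re) * Real.exp (-z.re) := by gcongr
              _ = 2 * (z.re * Real.exp (-z.re)) := by ring
              _ ≤ 2 * 1 := by gcongr
              _ = 2 := by ring
          have h7 : ‖z‖^m = ‖z‖^(m-1) * ‖z‖ := by rw [← pow_succ]; congr 1; omega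
          rw [h7]
          calc ‖lamc x m‖ * (‖z‖^(m-1) * ‖z‖) * Real.exp (-z.re)
              = ‖lamc x m‖ * ‖z‖^(m-1) * (‖z‖ * Real.exp (-z.re)) := by ring
            _ ≤ ‖lamc x m‖ * ‖z‖^(m-1) * 2 := by gcongr
            _ = _ := by ring
        have b4 := norm_sub_le (lamG x z) (∑ j ∈ Finset.range m, lamc x j * z^j)
        rw [hC2, mul_add, mul_add]
        linarith
      have h8 : ‖z‖^(m+1) = ‖z‖^(m-1) * ‖z‖^2 := by rw [← pow_add]; congr 1; omega
      rw [h8, mul_assoc] at hn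
      have := le_of_mul_le_mul_left hn (by positivity)
      linarith
    have h3 : (1 + z.re)^2 ≤ 4 * ‖z‖^2 := by nlinarith
    nlinarith [norm_nonneg (lamψ x m z)]

lemma lamψ_iter_bound (x : ℝ) (hx : 0 < x) (m : ℕ) (hm : 1 ≤ m) (r : ℕ) : ∃ K : ℝ, ∀ v : ℝ, 0 ≤ v →
    ‖iteratedDeriv r (lamψ x m) (v:ℂ)‖ ≤ K * (1 + v^2)⁻¹ := by
  obtain ⟨C, hC⟩ := lamψ_bound x hx m hm
  have hC0 : 0 ≤ C := by
    have := (norm_nonneg _).trans (hC 0 (by norm_num) (by norm_num))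
    simpa using this
  refine ⟨Nat.factorial r * (C * 4) / (1/2)^r, fun v hv => ?_⟩
  have hmem : ∀ z ∈ Metric.closedBall (v:ℂ) (1/2), -(1/2) + v ≤ z.re ∧ |z.im| ≤ 1/2 := by
    intro z hz
    rw [Metric.mem_closedBall, dist_eq_norm] at hz
    have h1 := (Complex.abs_re_le_norm (z - v)).trans hz
    have h2 := (Complex.abs_im_le_norm (z - v)).trans hz
    simp at h1 h2
    refine ⟨?_, by simpa using h2⟩
    have := (abs_le.1 h1).1
    linarith
  have hd : DifferentiableOn ℂ (lamψ x m) (Metric.closedBall (v:ℂ) (1/2)) :=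
    (lamψ_diff x m).mono fun z hz => by
      show |z.im| < 2
      linarith [(hmem z hz).2]
  have hdc : DiffContOnCl ℂ (lamψ x m) (Metric.ball (v:ℂ) (1/2)) := hd.diffContOnCl_ball subset_rfl
  have hb : ∀ z ∈ Metric.sphere (v:ℂ) (1/2), ‖lamψ x m z‖ ≤ (C * 4) * (1+v^2)⁻¹ := by
    intro z hz
    have h := hmem z (Metric.sphere_subset_closedBall hz)
    refine (hC z (by linarith) h.2).trans ?_
    rw [mul_assoc]
    refine mul_le_mul_of_nonneg_left ?_ hC0
    have h3 : (1+v^2) / 4 ≤ (1+z.re)^2 := by nlinarith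
    calc ((1+z.re)^2)⁻¹ ≤ ((1+v^2)/4)⁻¹ := inv_anti₀ (by positivity) h3
      _ = 4 * (1+v^2)⁻¹ := by rw [inv_div]; ring
  refine (Complex.norm_iteratedDeriv_le_of_forall_mem_sphere_norm_le r (by norm_num) hdc hb).trans (le_of_eq ?_)
  ring

lemma lamψ_hasDeriv (x : ℝ) (m r : ℕ) (v : ℝ) :
    HasDerivAt (fun v : ℝ => iteratedDeriv r (lamψ x m) (v:ℂ)) (iteratedDeriv (r+1) (lamψ x m) (v:ℂ)) v := by
  have ha : AnalyticAt ℂ (lamψ x m) (v:ℂ) :=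
    (lamψ_diff x m).analyticAt (lamS_open.mem_nhds (by simp [lamS]))
  have h := (ha.iterated_deriv r).differentiableAt.hasDerivAt
  rw [← iteratedDeriv_eq_iterate, ← iteratedDeriv_succ] at h
  exact h.comp_ofReal

lemma lamψ_em (x : ℝ) (hx : 0 < x) (m : ℕ) (hm : 1 ≤ m) (M : ℕ) :
    ∃ C : ℝ, ∀ t : ℝ, 0 < t → Summable (fun k : ℕ => lamψ x m ((t * (k+1) : ℝ):ℂ)) ∧
    ‖(∑' k : ℕ, lamψ x m ((t * (k+1) : ℝ):ℂ)) - (t:ℂ)⁻¹ * (∫ v in Set.Ioi (0:ℝ), lamψ x m (v:ℂ))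
      - ∑ r ∈ Finset.range (M+1), riemannZeta (-(r:ℂ)) * (t:ℂ)^r * 
          (lamc x (m+1+r) + lamc x m * ((-1)^r / (Nat.factorial (r+1) : ℂ)))‖
      ≤ C * t^M := by
  choose K hK using lamψ_iter_bound x hx m hm
  obtain ⟨C, hC⟩ := em_scaled (fun r v => iteratedDeriv r (lamψ x m) (v:ℂ)) K
    (fun r v _ => lamψ_hasDeriv x m r v) hK M
  refine ⟨C, fun t ht => ?_⟩
  have h := hC t ht
  simp only [iteratedDeriv_zero, Complex.ofReal_zero, lamψ_iter] at h
  refine ⟨h.1, ?_⟩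
  convert h.2 using 3
  refine Finset.sum_congr rfl fun r _ => ?_
  have : (Nat.factorial r : ℂ) ≠ 0 := by exact_mod_cast (Nat.factorial_pos r).ne'
  field_simp

lemma lamψ_int (x : ℝ) (hx : 0 < x) (m : ℕ) (hm : 1 ≤ m) :
    MeasureTheory.IntegrableOn (fun v : ℝ => lamψ x m (v:ℂ)) (Set.Ioi 0) := by
  obtain ⟨K, hK⟩ := lamψ_iter_bound x hx m hm 0
  simp only [iteratedDeriv_zero] at hK
  refine MeasureTheory.Integrable.mono' ((integrable_inv_one_add_sq.const_mul K).integrableOn) ?_ ?_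
  · apply ContinuousOn.aestronglyMeasurable _ measurableSet_Ioi
    intro v hv
    have := (lamψ_hasDeriv x m 0 v).continuousAt
    simp only [iteratedDeriv_zero] at this
    exact this.continuousWithinAt
  · refine (MeasureTheory.ae_restrict_mem measurableSet_Ioi).mono fun v hv => ?_
    exact hK v (le_of_lt hv)

/-! ### Part 4: the logarithm -/
noncomputable def lamL (z : ℂ) : ℂ := -Complex.log (lamD z)

lemma lamL_an : AnalyticAt ℂ lamL 0 := by
  have h1 : AnalyticAt ℂ lamD 0 := lamD_diff.analyticAt 0
  have h2 : AnalyticAt ℂ (fun z => Complex.log (lamD z)) 0 :=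
    h1.clog (by rw [lamD_zero]; exact Complex.one_mem_slitPlane)
  exact h2.neg

lemma lamL_deriv : ∀ᶠ z in 𝓝 (0:ℂ), z * deriv lamL z = 1 - lamG 1 z := by
  have hs : ∀ᶠ z in 𝓝 (0:ℂ), lamD z ∈ Complex.slitPlane := by
    apply lamD_diff.continuous.continuousAt.eventually_mem
    rw [lamD_zero]
    exact Complex.isOpen_slitPlane.mem_nhds Complex.one_mem_slitPlane
  filter_upwards [hs, lamS_zero] with z hz hzS
  have hd : HasDerivAt lamD (deriv lamD z) z := (lamD_diff z).hasDerivAt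
  have h1 : HasDerivAt lamL (-(deriv lamD z / lamD z)) z := (hd.clog hz).neg
  have h2 : HasDerivAt lamE (1 * lamD z + z * deriv lamD z) z := by
    have : lamE = fun z => z * lamD z := funext lamE_eq
    rw [this]
    exact (hasDerivAt_id z).mul hd
  have h3 : HasDerivAt lamE (Complex.exp (-z)) z := by
    unfold lamE
    have := (((hasDerivAt_id z).neg).cexp).const_sub 1
    simpa using this
  have h4 := h2.unique h3
  rw [h1.deriv]
  have hn := lamD_ne hzS
  unfold lamG
  rw [Complex.ofReal_one, one_mul, ← h4]
  field_simp
  ring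

lemma lamL_zero : lamL 0 = 0 := by simp [lamL, lamD_zero]

lemma tl_congr {f g : ℂ → ℂ} (hf : AnalyticAt ℂ f 0) (hg : AnalyticAt ℂ g 0) (h : f =ᶠ[𝓝 0] g) (r : ℕ) :
    tl f r 0 = tl g r 0 := by
  have h1 := iteratedDeriv_eq_tl f hf r
  have h2 := iteratedDeriv_eq_tl g hg r
  rw [h.iteratedDeriv_eq r, h2] at h1
  have : (r.factorial : ℂ) ≠ 0 := by exact_mod_cast r.factorial_ne_zero
  exact (mul_left_cancel₀ this h1).symm

lemma lamL_coef (n : ℕ) : tl lamL (n+1) 0 =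
    riemannZeta (-(n:ℂ)) * ((-1)^(n+1) / (Nat.factorial (n+1) : ℂ)) := by
  have hdA : AnalyticAt ℂ (deriv lamL) 0 := lamL_an.deriv
  have e1 : tl (fun z => z * deriv lamL z) (n+1) 0 = tl (deriv lamL) n 0 := by
    rw [tl_mul_self _ hdA.continuousAt]
  have hm : AnalyticAt ℂ (fun z => z * deriv lamL z) 0 := analyticAt_id.mul hdA
  have hG : AnalyticAt ℂ (fun z => 1 - lamG 1 z) 0 := analyticAt_const.sub (lamG_an 1)
  have e2 := tl_congr hm hG lamL_deriv (n+1)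
  have hf : (n.factorial : ℂ) ≠ 0 := by exact_mod_cast n.factorial_ne_zero
  have hf' : ((n+1).factorial : ℂ) ≠ 0 := by exact_mod_cast (n+1).factorial_ne_zero
  have e3 : tl (fun z => 1 - lamG 1 z) (n+1) 0 = - lamc 1 (n+1) := by
    have h1 := iteratedDeriv_eq_tl _ hG (n+1)
    have h2 := iteratedDeriv_eq_tl _ (lamG_an 1) (n+1)
    rw [iteratedDeriv_const_sub (Nat.succ_pos n), iteratedDeriv_neg, h2, lamG_coef] at h1
    apply mul_left_cancel₀ hf'
    rw [← h1]; ring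
  have e4 := iteratedDeriv_eq_tl _ lamL_an (n+1)
  rw [iteratedDeriv_succ', iteratedDeriv_eq_tl _ hdA n, ← e1, e2, e3] at e4
  have hb : riemannZeta (-(n:ℂ)) = - ((bernoulliFun (n+1) 1 : ℝ) : ℂ) / ((n:ℂ)+1) := by
    rw [riemannZeta_neg_nat_eq_bernoulli']
    have : bernoulliFun (n+1) 1 = ((bernoulli' (n+1) : ℚ) : ℝ) := by
      rw [bernoulliFun]
      have := Polynomial.bernoulli_eval_one (n+1)
      rw [← this]
      simp [Polynomial.eval_map, Polynomial.eval₂_at_one]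
    rw [this]; push_cast; rfl
  have hn1 : ((n:ℂ)+1) ≠ 0 := Nat.cast_add_one_ne_zero n
  apply mul_left_cancel₀ hf'
  rw [← e4, hb, lamc]
  rw [Nat.factorial_succ]
  push_cast
  field_simp

lemma lam_log (M : ℕ) : ∃ C δ : ℝ, 0 < δ ∧ ∀ t : ℝ, 0 < t → t < δ →
    ‖((-Real.log ((1 - Real.exp (-t))/t) : ℝ) : ℂ) - ∑ r ∈ range (M+1),
      riemannZeta (-(r:ℂ)) * ((-1)^(r+1) / (Nat.factorial (r+1) : ℂ)) * (t:ℂ)^(r+1)‖ ≤ C * t^(M+1) := by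
  obtain ⟨S, hS, hSd⟩ : ∃ S ∈ 𝓝 (0:ℂ), DifferentiableOn ℂ lamL S := by
    obtain ⟨S, hS, h⟩ := lamL_an.exists_mem_nhds_analyticOnNhd
    exact ⟨S, hS, h.differentiableOn⟩
  have hd := (tl_diff lamL S hS hSd (M+2))
  have hc : ContinuousAt (tl lamL (M+2)) 0 := (hd.differentiableAt hS).continuousAt
  have hb : ∀ᶠ z in 𝓝 (0:ℂ), ‖tl lamL (M+2) z‖ < ‖tl lamL (M+2) 0‖ + 1 :=
    hc.norm.eventually_lt continuousAt_const (by simp)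
  obtain ⟨ε, hε, hball⟩ := Metric.eventually_nhds_iff.1 hb
  generalize ‖tl lamL (M+2) 0‖ + 1 = B at hball
  refine ⟨B, min ε 1, by positivity, fun t ht ht' => ?_⟩
  have e1 : ((-Real.log ((1 - Real.exp (-t))/t) : ℝ) : ℂ) = lamL t := by
    unfold lamL
    have : lamD t = (((1 - Real.exp (-t))/t : ℝ) : ℂ) := by
      have h0 : (t:ℂ) ≠ 0 := by exact_mod_cast ht.ne'
      apply mul_left_cancel₀ h0
      rw [← lamE_eq, lamE]; push_cast; field_simp
    rw [this, ← Complex.ofReal_log]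
    · push_cast; rfl
    · have : Real.exp (-t) ≤ 1 := by rw [Real.exp_le_one_iff]; linarith
      apply div_nonneg <;> linarith
  rw [e1, tl_expand lamL (M+2) t, Finset.sum_range_succ', tl_zero, lamL_zero]
  simp_rw [lamL_coef]
  have : ∀ a b : ℂ, a + 0 * (t:ℂ)^0 + b - a = b := by intros; ring
  rw [this, norm_mul, norm_pow, Complex.norm_real, Real.norm_of_nonneg ht.le, mul_comm]
  have h1 := (hball (y := (t:ℂ)) (by simp [abs_of_pos ht]; exact ht'.trans_le (min_le_left _ _))).le
  have h2 : t^(M+2) ≤ t^(M+1) := pow_le_pow_of_le_one ht.le (ht'.le.trans (min_le_right _ _)) (by omega)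
  have hB : 0 ≤ B := (norm_nonneg _).trans h1
  gcongr

/-! ### Part 5: the Mellin transform -/
noncomputable def lamf (x : ℝ) (m : ℕ) (u : ℝ) : ℂ :=
  (u:ℂ)^m * lamψ x m u + ∑ j ∈ range m, lamc x j * (Set.Ioi (1:ℝ)).indicator (fun t : ℝ => (t:ℂ)^((j:ℂ)-1)) u

lemma real_mem_lamS (u : ℝ) : (u:ℂ) ∈ lamS := by simp [lamS]

lemma cpow_sub_one_nat {u : ℝ} (hu : 0 < u) (j : ℕ) : (u:ℂ)^((j:ℂ)-1) = (u:ℂ)^j / u := by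
  rw [Complex.cpow_sub _ _ (by exact_mod_cast hu.ne'), Complex.cpow_natCast, Complex.cpow_one]

lemma lamψ_cont (x : ℝ) (m : ℕ) : Continuous (fun u : ℝ => lamψ x m (u:ℂ)) := by
  rw [continuous_iff_continuousAt]
  intro u
  have := ((lamψ_diff x m).differentiableAt (lamS_open.mem_nhds (real_mem_lamS u))).continuousAt
  exact ContinuousAt.comp (f := fun u : ℝ => (u:ℂ)) this Complex.continuous_ofReal.continuousAt

lemma lamf_locint (x : ℝ) (m : ℕ) : MeasureTheory.LocallyIntegrableOn (lamf x m) (Set.Ioi 0) := by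
  unfold lamf
  apply MeasureTheory.LocallyIntegrableOn.add
  · apply ContinuousOn.locallyIntegrableOn _ measurableSet_Ioi
    have := lamψ_cont x m
    fun_prop
  · rw [MeasureTheory.locallyIntegrableOn_iff isOpen_Ioi.isLocallyClosed]
    intro k hk hkc
    apply MeasureTheory.integrable_finsetSum
    intro j _
    apply MeasureTheory.Integrable.const_mul
    apply MeasureTheory.Integrable.indicator _ measurableSet_Ioi
    apply ContinuousOn.integrableOn_compact hkc
    intro t ht
    apply ContinuousAt.continuousWithinAt
    have : (t:ℂ) ∈ Complex.slitPlane := Complex.ofReal_mem_slitPlane.2 (hk ht)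
    exact (Complex.continuous_ofReal.continuousAt).cpow continuousAt_const this

lemma lamf_eq (x : ℝ) (m : ℕ) {u : ℝ} (hu : 0 < u) : lamf x m u =
    lamG x u / u - lamc x m * ((u:ℂ)^((m:ℂ)-1) * Complex.exp (-u))
     - ∑ j ∈ range m, lamc x j * (Set.Ioc (0:ℝ) 1).indicator (fun t : ℝ => (t:ℂ)^((j:ℂ)-1)) u := by
  have hu0 : (u:ℂ) ≠ 0 := by exact_mod_cast hu.ne'
  have h : ∑ j ∈ range m, lamc x j * (Set.Ioi (1:ℝ)).indicator (fun t : ℝ => (t:ℂ)^((j:ℂ)-1)) u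
     + ∑ j ∈ range m, lamc x j * (Set.Ioc (0:ℝ) 1).indicator (fun t : ℝ => (t:ℂ)^((j:ℂ)-1)) u
     = (∑ j ∈ range m, lamc x j * (u:ℂ)^j) / u := by
    rw [← Finset.sum_add_distrib, Finset.sum_div]
    refine Finset.sum_congr rfl fun j _ => ?_
    by_cases h1 : 1 < u
    · rw [Set.indicator_of_mem (by exact h1), Set.indicator_of_notMem (by simp [h1]), cpow_sub_one_nat hu]
      ring
    · rw [Set.indicator_of_notMem (by exact h1), Set.indicator_of_mem (show u ∈ Set.Ioc (0:ℝ) 1 from ⟨hu, not_lt.1 h1⟩), cpow_sub_one_nat hu]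
      ring
  rw [lamf, lamψ_eq x m u, eq_sub_of_add_eq h, cpow_sub_one_nat hu]
  field_simp
  ring

lemma lamf_zero (x : ℝ) (m : ℕ) : lamf x m =O[𝓝[>] 0] (fun u : ℝ => u ^ (-(-(m:ℝ)))) := by
  have hc : (fun u : ℝ => lamψ x m (u:ℂ)) =O[𝓝[>] 0] (fun _ => (1:ℝ)) :=
    ((lamψ_cont x m).continuousAt.mono_left nhdsWithin_le_nhds).isBigO_one ℝ
  have h2 : (fun u : ℝ => (u:ℂ)^m * lamψ x m (u:ℂ)) =O[𝓝[>] 0] (fun u : ℝ => u^m * 1) := by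
    refine IsBigO.mul ?_ hc
    apply IsBigO.of_bound 1
    filter_upwards with u
    simp
  refine (h2.congr' ?_ ?_)
  · filter_upwards [self_mem_nhdsWithin, nhdsWithin_le_nhds (Iio_mem_nhds (zero_lt_one' ℝ))] with u hu hu1
    rw [lamf, Finset.sum_eq_zero, add_zero]
    intro j _
    rw [Set.indicator_of_notMem (by simpa using (le_of_lt hu1)), mul_zero]
  · filter_upwards with u
    rw [neg_neg, Real.rpow_natCast, mul_one]

lemma lamf_top (x : ℝ) (hx : 0 < x) (hx1 : x ≤ 1) (m : ℕ) :
    lamf x m =O[atTop] (fun u : ℝ => Real.exp (-(x/2) * u)) := by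
  have h1 : (fun u : ℝ => lamG x u / u) =O[atTop] (fun u : ℝ => Real.exp (-(x/2) * u)) := by
    apply IsBigO.of_bound 2
    filter_upwards [eventually_ge_atTop 1] with u hu
    have := lamG_norm x (real_mem_lamS u) (by simpa using hu)
    rw [Complex.ofReal_re] at this
    rw [norm_div, Complex.norm_real, Real.norm_of_nonneg (by linarith : (0:ℝ) ≤ u), Real.norm_of_nonneg (Real.exp_pos _).le,
      div_le_iff₀ (by linarith)]
    rw [Complex.norm_real, Real.norm_of_nonneg (by linarith)] at this
    refine this.trans ?_
    rw [mul_comm]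
    have : Real.exp (-(x*u)) ≤ Real.exp (-(x/2)*u) := by
      apply Real.exp_le_exp.2; nlinarith
    gcongr
  have h2 : (fun u : ℝ => (u:ℂ)^((m:ℂ)-1) * Complex.exp (-u)) =O[atTop] (fun u : ℝ => Real.exp (-(x/2) * u)) := by
    have h3 := (isLittleO_pow_exp_pos_mul_atTop (k := m) (half_pos zero_lt_one : (0:ℝ) < 1/2)).isBigO
    have h4 : (fun u : ℝ => (u:ℂ)^((m:ℂ)-1) * Complex.exp (-u)) =O[atTop] (fun u : ℝ => u^m * Real.exp (-u)) := by
      apply IsBigO.of_bound 1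
      filter_upwards [eventually_ge_atTop 1] with u hu
      rw [cpow_sub_one_nat (by linarith)]
      rw [norm_mul, norm_div, norm_pow, Complex.norm_real, norm_mul, norm_pow, Complex.norm_exp]
      rw [one_mul]
      simp only [Complex.neg_re, Complex.ofReal_re, Real.norm_eq_abs, Real.abs_exp]
      gcongr
      apply div_le_self (by positivity)
      rw [abs_of_nonneg] <;> linarith
    refine h4.trans ((h3.mul (isBigO_refl (fun u : ℝ => Real.exp (-u)) _)).trans ?_)
    apply IsBigO.of_bound 1
    filter_upwards [eventually_ge_atTop 0] with u hu
    rw [← Real.exp_add, Real.norm_eq_abs, Real.norm_eq_abs, Real.abs_exp, Real.abs_exp, one_mul]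
    apply Real.exp_le_exp.2; nlinarith
  refine (h1.sub (h2.const_mul_left (lamc x m))).congr' ?_ EventuallyEq.rfl
  filter_upwards [eventually_gt_atTop 1] with u hu
  rw [lamf_eq x m (by linarith), Finset.sum_eq_zero, sub_zero]
  intro j _
  rw [Set.indicator_of_notMem (by simp [hu]), mul_zero]

lemma lamf_conv (x : ℝ) (hx : 0 < x) (hx1 : x ≤ 1) (m : ℕ) {s : ℂ} (hs : -(m:ℝ) < s.re) :
    MellinConvergent (lamf x m) s :=
  mellinConvergent_of_isBigO_rpow_exp (half_pos hx) (lamf_locint x m) (lamf_top x hx hx1 m) (lamf_zero x m) hs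

lemma lamf_mdiff (x : ℝ) (hx : 0 < x) (hx1 : x ≤ 1) (m : ℕ) {s : ℂ} (hs : -(m:ℝ) < s.re) :
    DifferentiableAt ℂ (mellin (lamf x m)) s :=
  mellin_differentiableAt_of_isBigO_rpow_exp (half_pos hx) (lamf_locint x m) (lamf_top x hx hx1 m) (lamf_zero x m) hs

lemma mellin_F0 (x : ℝ) (hx : 0 < x) (hx1 : x ≤ 1) {s : ℂ} (hs : 1 < s.re) :
    mellin (fun u : ℝ => lamG x u / u) s = Complex.Gamma s * HurwitzZeta.hurwitzZeta (x : UnitAddCircle) s := by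
  have hz := HurwitzZeta.hasSum_hurwitzZeta_of_one_lt_re (a := x) ⟨hx.le, hx1⟩ hs
  have key := hasSum_mellin (a := fun _ : ℕ => (1:ℂ)) (p := fun n : ℕ => (n:ℝ) + x)
    (F := fun u : ℝ => lamG x u / u) (s := s) (fun i => Or.inr (by positivity)) (by linarith) ?_ ?_
  · refine key.unique ?_
    have e : (fun n : ℕ => Complex.Gamma s * 1 / (((n:ℝ) + x : ℝ) : ℂ) ^ s) =
        fun n : ℕ => Complex.Gamma s * (1 / ((n:ℂ) + (x:ℂ)) ^ s) := by
      funext n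
      push_cast
      ring
    rw [e]
    exact hz.mul_left (Complex.Gamma s)
  · intro t ht
    have ht : 0 < t := ht
    have hE : lamE t ≠ 0 := lamE_ne (real_mem_lamS t) (by exact_mod_cast ht.ne')
    have h0 : (t:ℂ) ≠ 0 := by exact_mod_cast ht.ne'
    have e : lamG x t / t = Complex.exp (-(x*t)) * (1 - Complex.exp (-t))⁻¹ := by
      have h := lamG_mul x (real_mem_lamS t)
      have h' : (1 - Complex.exp (-t)) = lamE t := rfl
      rw [h']
      rw [div_eq_iff h0, mul_right_comm, ← div_eq_mul_inv, eq_div_iff hE, h]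
      ring
    rw [e]
    have hg := (hasSum_geometric_of_norm_lt_one (ξ := Complex.exp (-(t:ℂ))) (by
      rw [Complex.norm_exp]; simpa using ht)).mul_left (Complex.exp (-(x*t)))
    have e' : (fun n : ℕ => (1:ℂ) * ((Real.exp (-((n:ℝ)+x) * t) : ℝ) : ℂ)) =
        fun n : ℕ => Complex.exp (-(x*t)) * Complex.exp (-(t:ℂ))^n := by
      funext n
      rw [← Complex.exp_nat_mul, ← Complex.exp_add, one_mul]
      push_cast
      congr 1
      ring
    rw [e']
    exact hg
  · have := hz.summable.norm
    refine this.congr fun n => ?_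
    rw [norm_div, norm_one, ← Complex.ofReal_natCast, ← Complex.ofReal_add,
      Complex.norm_cpow_eq_rpow_re_of_pos (by positivity)]

lemma mellin_expand (x : ℝ) (hx : 0 < x) (hx1 : x ≤ 1) (m : ℕ) {s : ℂ} (hs : 1 < s.re) :
    Complex.Gamma s * HurwitzZeta.hurwitzZeta (x : UnitAddCircle) s =
      mellin (lamf x m) s + lamc x m * Complex.Gamma (s + m - 1) + ∑ j ∈ range m, lamc x j / (s + j - 1) := by
  have c1 := lamf_conv x hx hx1 m (s := s) (by have : (0:ℝ) ≤ m := by positivity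
                                               linarith)
  have hre : 0 < (s + ((m:ℂ) - 1)).re := by
    have : (0:ℝ) ≤ m := by positivity
    simp; linarith
  have c2 : MellinConvergent (fun u : ℝ => (u:ℂ)^((m:ℂ)-1) • ((Real.exp (-u) : ℝ) : ℂ)) s := by
    rw [MellinConvergent.cpow_smul]
    have := Complex.GammaIntegral_convergent hre
    refine this.congr_fun (fun u _ => ?_) measurableSet_Ioi
    simp only [smul_eq_mul]; ring
  have v2 : mellin (fun u : ℝ => (u:ℂ)^((m:ℂ)-1) • ((Real.exp (-u) : ℝ) : ℂ)) s = Complex.Gamma (s + m - 1) := by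
    rw [mellin_cpow_smul, ← Complex.GammaIntegral_eq_mellin, ← Complex.Gamma_eq_integral hre]
    congr 1; ring
  have c3 : ∀ j : ℕ, HasMellin (Set.indicator (Set.Ioc 0 1) (fun t : ℝ => (t:ℂ) ^ ((j:ℂ)-1))) s (1 / (s + ((j:ℂ)-1))) := by
    intro j
    apply hasMellin_cpow_Ioc
    have : (0:ℝ) ≤ j := by positivity
    simp; linarith
  rw [← mellin_F0 x hx hx1 hs, ← v2]
  unfold mellin
  simp only [smul_eq_mul]
  rw [← MeasureTheory.integral_const_mul]
  have hsum : ∑ j ∈ range m, lamc x j / (s + j - 1) = ∫ t : ℝ in Set.Ioi 0, ∑ j ∈ range m,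
      lamc x j * ((t:ℂ)^(s-1) * (Set.Ioc (0:ℝ) 1).indicator (fun t : ℝ => (t:ℂ)^((j:ℂ)-1)) t) := by
    rw [MeasureTheory.integral_finsetSum]
    · refine Finset.sum_congr rfl fun j _ => ?_
      rw [MeasureTheory.integral_const_mul]
      have := (c3 j).2
      unfold mellin at this
      simp only [smul_eq_mul] at this
      rw [this]; ring_nf
    · intro j _
      exact MeasureTheory.Integrable.const_mul (c3 j).1 _
  rw [hsum, ← MeasureTheory.integral_add, ← MeasureTheory.integral_add]
  · refine MeasureTheory.setIntegral_congr_fun measurableSet_Ioi fun u hu => ?_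
    rw [lamf_eq x m hu, mul_sub, mul_sub, Finset.mul_sum]
    have : ∀ j, (u:ℂ)^(s-1) * (lamc x j * (Set.Ioc (0:ℝ) 1).indicator (fun t : ℝ => (t:ℂ)^((j:ℂ)-1)) u)
      = lamc x j * ((u:ℂ)^(s-1) * (Set.Ioc (0:ℝ) 1).indicator (fun t : ℝ => (t:ℂ)^((j:ℂ)-1)) u) := by
      intro j; ring
    simp only [this]
    push_cast
    ring
  · exact c1.add (MeasureTheory.Integrable.const_mul c2 _)
  · apply MeasureTheory.integrable_finsetSum
    intro j _
    exact MeasureTheory.Integrable.const_mul (c3 j).1 _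
  · exact c1
  · exact MeasureTheory.Integrable.const_mul c2 _

lemma mellin_at (x : ℝ) (hx : 0 < x) (m : ℕ) (hm : 1 ≤ m) :
    mellin (lamf x m) (1 - m) + ∑ j ∈ range m, lamc x j / ((1 - m) + j - 1) =
      ∫ v in Set.Ioi (0:ℝ), lamψ x m (v:ℂ) := by
  have e : ∀ j ∈ range m, MeasureTheory.IntegrableOn ((Set.Ioi (1:ℝ)).indicator (fun t : ℝ => (t:ℂ)^((j:ℂ)-m-1))) (Set.Ioi 0) ∧
      ∫ t in Set.Ioi (0:ℝ), (Set.Ioi (1:ℝ)).indicator (fun t : ℝ => (t:ℂ)^((j:ℂ)-m-1)) t = - 1 / (j - m) := by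
    intro j hj
    have hjm : (j:ℝ) < m := by exact_mod_cast Finset.mem_range.1 hj
    have hre : ((j:ℂ)-m-1).re < -1 := by simp; linarith
    constructor
    · unfold MeasureTheory.IntegrableOn
      rw [MeasureTheory.integrable_indicator_iff measurableSet_Ioi]
      have := integrableOn_Ioi_cpow_of_lt hre (zero_lt_one)
      exact this.mono_measure MeasureTheory.Measure.restrict_le_self |>.mono_set (le_refl _)
    · rw [MeasureTheory.setIntegral_indicator measurableSet_Ioi]
      have : Set.Ioi (0:ℝ) ∩ Set.Ioi 1 = Set.Ioi 1 := by
        ext t; simp only [Set.mem_inter_iff, Set.mem_Ioi]; constructor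
        · exact fun h => h.2
        · exact fun h => ⟨by linarith, h⟩
      rw [this, integral_Ioi_cpow_of_lt hre zero_lt_one]
      simp
  have h1 : mellin (lamf x m) (1 - m) = ∫ v in Set.Ioi (0:ℝ), (lamψ x m (v:ℂ) +
      ∑ j ∈ range m, lamc x j * (Set.Ioi (1:ℝ)).indicator (fun t : ℝ => (t:ℂ)^((j:ℂ)-m-1)) v) := by
    unfold mellin
    refine MeasureTheory.setIntegral_congr_fun measurableSet_Ioi fun u hu => ?_
    have hu : 0 < u := hu
    have h0 : (u:ℂ) ≠ 0 := by exact_mod_cast hu.ne'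
    have e1 : (u:ℂ)^(1 - (m:ℂ) - 1) = ((u:ℂ)^m)⁻¹ := by
      rw [show (1:ℂ) - m - 1 = -m by ring, Complex.cpow_neg, Complex.cpow_natCast]
    simp only [smul_eq_mul]
    rw [lamf, mul_add, e1, Finset.mul_sum]
    congr 1
    · field_simp
    · refine Finset.sum_congr rfl fun j _ => ?_
      by_cases h1 : u ∈ Set.Ioi (1:ℝ)
      · rw [Set.indicator_of_mem h1, Set.indicator_of_mem h1, show (j:ℂ) - m - 1 = (j - 1) - m by ring,
          Complex.cpow_sub ((j:ℂ)-1) _ h0 , Complex.cpow_natCast]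
        ring
      · rw [Set.indicator_of_notMem h1, Set.indicator_of_notMem h1]; ring
  rw [h1, MeasureTheory.integral_add (lamψ_int x hx m hm), MeasureTheory.integral_finsetSum, add_assoc,
    ← Finset.sum_add_distrib, Finset.sum_eq_zero, add_zero]
  · intro j hj
    rw [MeasureTheory.integral_const_mul, (e j hj).2, show (1:ℂ) - m + j - 1 = j - m by ring]
    ring
  · intro j hj
    exact MeasureTheory.Integrable.const_mul (e j hj).1 _
  · apply MeasureTheory.integrable_finsetSum
    intro j hj
    exact MeasureTheory.Integrable.const_mul (e j hj).1 _

/-! ### Part 6: the derivative of the Hurwitz zeta function -/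
noncomputable def lamP (n : ℕ) (s : ℂ) : ℂ := ∏ i ∈ range n, (s + i)

lemma lamP_diff (n : ℕ) : Differentiable ℂ (lamP n) := by
  unfold lamP; fun_prop

lemma lamP_Gamma (n : ℕ) {s : ℂ} (hs : 0 < s.re) : Complex.Gamma (s + n) = lamP n s * Complex.Gamma s := by
  induction n with
  | zero => simp [lamP]
  | succ n ih =>
    have h0 : s + n ≠ 0 := by
      intro h
      have := congrArg Complex.re h
      simp at this
      have : (0:ℝ) ≤ n := by positivity
      linarith
    have := Complex.Gamma_add_one (s + n) h0
    push_cast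
    rw [← add_assoc, this, ih, lamP, lamP, Finset.prod_range_succ]
    ring

lemma lamP_inv (n : ℕ) (s : ℂ) : (Complex.Gamma s)⁻¹ = lamP n s * (Complex.Gamma (s + n))⁻¹ := by
  induction n with
  | zero => simp [lamP]
  | succ n ih =>
    rw [ih, Complex.one_div_Gamma_eq_self_mul_one_div_Gamma_add_one (s + n), lamP, lamP, Finset.prod_range_succ]
    push_cast
    rw [add_assoc]
    ring

lemma lamP_at (n : ℕ) : lamP n (-(n:ℂ)) = (-1)^n * (n.factorial : ℂ) := by
  unfold lamP
  rw [← Finset.prod_range_reflect, ← Finset.prod_range_add_one_eq_factorial]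
  push_cast
  have : (-1:ℂ)^n = ∏ i ∈ range n, (-1:ℂ) := by simp
  rw [this, ← Finset.prod_mul_distrib]
  refine Finset.prod_congr rfl fun i hi => ?_
  have hi := Finset.mem_range.1 hi
  rw [Nat.sub_sub, Nat.cast_sub (by omega)]
  push_cast
  ring

lemma lamP_deriv (n : ℕ) (b : ℂ) (hb : ∀ i ∈ range n, b + i ≠ 0) :
    HasDerivAt (lamP n) (lamP n b * ∑ i ∈ range n, (b + i)⁻¹) b := by
  induction n with
  | zero =>
    have e : lamP 0 = fun _ => (1:ℂ) := by funext s; simp [lamP]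
    rw [e]
    exact (hasDerivAt_const b (1:ℂ)).congr_deriv (by simp)
  | succ n ih =>
    have h1 := ih fun i hi => hb i (Finset.mem_range.2 (by have := Finset.mem_range.1 hi; omega))
    have hn := hb n (by simp)
    have h2 : HasDerivAt (fun s : ℂ => s + n) 1 b := (hasDerivAt_id b).add_const _
    have h3 := h1.mul h2
    have e : lamP (n+1) = lamP n * fun s : ℂ => s + n := by
      funext s; simp [lamP, Finset.prod_range_succ]
    rw [e]
    refine h3.congr_deriv ?_
    rw [Finset.sum_range_succ, Pi.mul_apply]
    field_simp

lemma lamP_deriv_at (n : ℕ) : HasDerivAt (lamP n) (-(lamP n (-(n:ℂ)) * ((harmonic n : ℚ) : ℂ))) (-(n:ℂ)) := by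
  have h := lamP_deriv n (-(n:ℂ)) (by
    intro i hi
    have hi := Finset.mem_range.1 hi
    intro h
    have : (i:ℂ) = n := by linear_combination h
    have : i = n := by exact_mod_cast this
    omega)
  refine h.congr_deriv (Eq.symm ?_)
  rw [← mul_neg]
  congr 1
  unfold harmonic
  push_cast
  rw [← Finset.sum_range_reflect, ← Finset.sum_neg_distrib]
  refine Finset.sum_congr rfl fun i hi => ?_
  have hi := Finset.mem_range.1 hi
  rw [← inv_neg]
  congr 1
  rw [Nat.sub_sub, Nat.cast_sub (by omega)]
  push_cast
  ring

noncomputable def lamK (x : ℝ) (m : ℕ) (s : ℂ) : ℂ :=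
  mellin (lamf x m) s + ∑ j ∈ range m, lamc x j / (s + j - 1)

noncomputable def lamR (x : ℝ) (n : ℕ) (s : ℂ) : ℂ :=
  (Complex.Gamma s)⁻¹ * lamK x (n+1) s + lamc x (n+1) * lamP n s

def lamT (m : ℕ) : Set ℂ := {s | -(m:ℝ) < s.re} ∩ ⋂ j ∈ range m, {s : ℂ | s + j - 1 ≠ 0}

lemma lamT_open (m : ℕ) : IsOpen (lamT m) := by
  apply IsOpen.inter
  · exact isOpen_lt continuous_const Complex.continuous_re
  · apply isOpen_biInter_finset
    intro j _
    exact isOpen_ne_fun (by fun_prop) continuous_const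

lemma lamK_diff (x : ℝ) (hx : 0 < x) (hx1 : x ≤ 1) (m : ℕ) {s : ℂ} (hs : s ∈ lamT m) :
    DifferentiableAt ℂ (lamK x m) s := by
  have h2 : ∀ j ∈ range m, s + j - 1 ≠ 0 := by simpa [lamT] using hs.2
  unfold lamK
  apply DifferentiableAt.add (lamf_mdiff x hx hx1 m hs.1)
  apply DifferentiableAt.fun_sum
  intro j hj
  have := h2 j hj
  fun_prop (disch := exact this)

lemma lamR_diff (x : ℝ) (hx : 0 < x) (hx1 : x ≤ 1) (n : ℕ) {s : ℂ} (hs : s ∈ lamT (n+1)) :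
    DifferentiableAt ℂ (lamR x n) s := by
  unfold lamR
  exact ((Complex.differentiable_one_div_Gamma s).mul (lamK_diff x hx hx1 _ hs)).add
    (((lamP_diff n) s).const_mul _)

lemma hz_diff (x : ℝ) (n : ℕ) {s : ℂ} (hs : s ∈ lamT (n+1)) :
    DifferentiableAt ℂ (HurwitzZeta.hurwitzZeta (x : UnitAddCircle)) s := by
  apply HurwitzZeta.differentiableAt_hurwitzZeta
  have h2 : ∀ j ∈ range (n+1), s + j - 1 ≠ 0 := by simpa [lamT] using hs.2
  have := h2 0 (by simp)
  intro h
  apply this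
  simp [h]

lemma hz_eq_right (x : ℝ) (hx : 0 < x) (hx1 : x ≤ 1) (n : ℕ) {s : ℂ} (hs : 1 < s.re) :
    HurwitzZeta.hurwitzZeta (x : UnitAddCircle) s = lamR x n s := by
  have h := mellin_expand x hx hx1 (n+1) hs
  have hG : Complex.Gamma s ≠ 0 := Complex.Gamma_ne_zero_of_re_pos (by linarith)
  have h2 := lamP_Gamma n (s := s) (by linarith)
  have h3 : s + ((n+1 : ℕ) : ℂ) - 1 = s + n := by push_cast; ring
  rw [h3, h2] at h
  unfold lamR lamK
  apply mul_left_cancel₀ hG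
  rw [h, mul_add, ← mul_assoc (Complex.Gamma s) (Complex.Gamma s)⁻¹, mul_inv_cancel₀ hG]
  ring

lemma hz_eventually (x : ℝ) (hx : 0 < x) (hx1 : x ≤ 1) (n : ℕ) :
    HurwitzZeta.hurwitzZeta (x : UnitAddCircle) =ᶠ[𝓝 (-(n:ℂ))] lamR x n := by
  have hT : lamT (n+1) ∈ 𝓝 (-(n:ℂ)) := by
    apply (lamT_open _).mem_nhds
    refine ⟨by simp, ?_⟩
    simp only [Set.mem_iInter, Finset.mem_range, Set.mem_ofPred_eq]
    intro j hj h
    have : (j:ℂ) = (n+1 : ℕ) := by push_cast; linear_combination h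
    have : j = n+1 := by exact_mod_cast this
    omega
  have a1 : AnalyticAt ℂ (HurwitzZeta.hurwitzZeta (x : UnitAddCircle)) (-(n:ℂ)) :=
    DifferentiableOn.analyticAt (fun s hs => (hz_diff x n hs).differentiableWithinAt) hT
  have a2 : AnalyticAt ℂ (lamR x n) (-(n:ℂ)) :=
    DifferentiableOn.analyticAt (fun s hs => (lamR_diff x hx hx1 n hs).differentiableWithinAt) hT
  refine (AnalyticAt.frequently_eq_iff_eventually_eq a1 a2).1 ?_
  set V : Set ℂ := {s | -((n+1 : ℕ):ℝ) < s.re} ∩ {s | 0 < s.im} with hV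
  have hVo : IsOpen V := (isOpen_lt continuous_const Complex.continuous_re).inter
    (isOpen_lt continuous_const Complex.continuous_im)
  have hVT : V ⊆ lamT (n+1) := by
    rintro s ⟨h1, h2⟩
    refine ⟨h1, ?_⟩
    simp only [Set.mem_iInter, Finset.mem_range, Set.mem_ofPred_eq]
    intro j hj h
    have := congrArg Complex.im h
    simp at this
    have h2 : 0 < s.im := h2
    linarith
  have hVc : IsPreconnected V :=
    ((convex_halfSpace_re_gt _).inter (convex_halfSpace_im_gt _)).isPreconnected
  have b1 : AnalyticOnNhd ℂ (HurwitzZeta.hurwitzZeta (x : UnitAddCircle)) V :=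
    DifferentiableOn.analyticOnNhd (fun s hs => (hz_diff x n (hVT hs)).differentiableWithinAt) hVo
  have b2 : AnalyticOnNhd ℂ (lamR x n) V :=
    DifferentiableOn.analyticOnNhd (fun s hs => (lamR_diff x hx hx1 n (hVT hs)).differentiableWithinAt) hVo
  have hp : (2 + Complex.I) ∈ V := by
    constructor
    · simp; have : (0:ℝ) ≤ n := by positivity
      linarith
    · simp
  have hEq := b1.eqOn_of_preconnected_of_eventuallyEq b2 hVc hp (by
    have : {s : ℂ | 1 < s.re} ∈ 𝓝 (2 + Complex.I) :=
      (isOpen_lt continuous_const Complex.continuous_re).mem_nhds (by simp)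
    filter_upwards [this] with s hs
    exact hz_eq_right x hx hx1 n hs)
  have htend : Tendsto (fun e : ℝ => -(n:ℂ) + e * Complex.I) (𝓝[>] 0) (𝓝[≠] (-(n:ℂ))) := by
    apply tendsto_nhdsWithin_of_tendsto_nhds_of_eventually_within
    · have : Continuous (fun e : ℝ => -(n:ℂ) + e * Complex.I) := by fun_prop
      have h := this.tendsto 0
      simp only [Complex.ofReal_zero, zero_mul, add_zero] at h
      exact h.mono_left nhdsWithin_le_nhds
    · filter_upwards [self_mem_nhdsWithin] with e he
      have he : 0 < e := he
      simp [he.ne']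
  apply htend.frequently
  apply Eventually.frequently
  filter_upwards [self_mem_nhdsWithin] with e he
  have he : 0 < e := he
  apply hEq
  constructor
  · simp
  · simpa using he

lemma hz_deriv (x : ℝ) (hx : 0 < x) (hx1 : x ≤ 1) (m : ℕ) (hm : 1 ≤ m) :
    deriv (fun s : ℂ => HurwitzZeta.hurwitzZeta (x : UnitAddCircle) s) (1 - (m:ℂ)) =
     (-1)^(m-1) * ((m-1).factorial : ℂ) * ((∫ v in Set.Ioi (0:ℝ), lamψ x m (v:ℂ)) - ((harmonic (m-1) : ℚ) : ℂ) * lamc x m) := by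
  obtain ⟨n, rfl⟩ : ∃ n, m = n + 1 := ⟨m-1, by omega⟩
  have e0 : (1:ℂ) - ((n+1:ℕ):ℂ) = -(n:ℂ) := by push_cast; ring
  have hK := mellin_at x hx (n+1) hm
  have hT : -(n:ℂ) ∈ lamT (n+1) := by
    refine ⟨by simp, ?_⟩
    simp only [Set.mem_iInter, Finset.mem_range, Set.mem_ofPred_eq]
    intro j hj h
    have : (j:ℂ) = (n+1 : ℕ) := by push_cast; linear_combination h
    have : j = n+1 := by exact_mod_cast this
    omega
  have hK' : lamK x (n+1) (-(n:ℂ)) = ∫ v in Set.Ioi (0:ℝ), lamψ x (n+1) (v:ℂ) := by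
    rw [← hK, lamK, e0]
  rw [e0, (hz_eventually x hx hx1 n).deriv_eq, Nat.add_sub_cancel]
  have hg : HasDerivAt (fun s => (Complex.Gamma s)⁻¹) (lamP n (-(n:ℂ))) (-(n:ℂ)) := by
    have e1 : (fun s => (Complex.Gamma s)⁻¹) = fun s => (s + n) * (lamP n s * (Complex.Gamma (s + (n+1:ℕ)))⁻¹) := by
      funext s
      rw [lamP_inv (n+1) s, lamP, lamP, Finset.prod_range_succ]
      ring
    rw [e1]
    have hd : DifferentiableAt ℂ (fun s => lamP n s * (Complex.Gamma (s + (n+1:ℕ)))⁻¹) (-(n:ℂ)) := by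
      apply ((lamP_diff n) _).mul
      exact DifferentiableAt.comp (g := fun s => (Complex.Gamma s)⁻¹) (-(n:ℂ)) (Complex.differentiable_one_div_Gamma _)
        (differentiableAt_id.add_const _)
    have := ((hasDerivAt_id (-(n:ℂ))).add_const (n:ℂ)).mul hd.hasDerivAt
    refine this.congr_deriv ?_
    simp
  have hg0 : (Complex.Gamma (-(n:ℂ)))⁻¹ = 0 := by
    rw [Complex.Gamma_neg_nat_eq_zero, inv_zero]
  have := ((hg.mul (lamK_diff x hx hx1 (n+1) hT).hasDerivAt).add ((lamP_deriv_at n).const_mul (lamc x (n+1)))).deriv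
  have e2 : lamR x n = ((fun s => (Complex.Gamma s)⁻¹) * lamK x (n+1)) + fun s => lamc x (n+1) * lamP n s := rfl
  rw [e2, this, hg0, hK', lamP_at]
  ring

/-! ### Part 7: assembly -/
lemma hasSum_zeta_shift (p : ℕ) (hp : 1 < p) :
    HasSum (fun k : ℕ => 1 / ((k:ℂ)+1)^p) (riemannZeta p) := by
  have hs : Summable (fun n : ℕ => 1 / (n:ℂ)^p) := by
    have := (Real.summable_one_div_nat_pow (p := p)).2 hp
    have := Complex.hasSum_ofReal.2 this.hasSum
    refine this.summable.congr fun n => ?_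
    push_cast; rfl
  have h := hs.hasSum
  rw [← zeta_nat_eq_tsum_of_gt_one hp] at h
  have h2 := (hasSum_nat_add_iff' (f := fun n : ℕ => 1 / (n:ℂ)^p) 1).2 h
  simpa [show p ≠ 0 by omega] using h2

lemma lam_term (x : ℝ) (m : ℕ) (t : ℝ) (ht : 0 < t) (k : ℕ) :
    (((Real.exp (-t)) ^ (((k : ℝ) + 1) * x) / (((k : ℝ) + 1) ^ m * (1 - (Real.exp (-t)) ^ (k + 1))) : ℝ) : ℂ)
     = ∑ j ∈ range m, lamc x j * ((t:ℂ)^((j:ℤ)-1)) * (1 / ((k:ℂ)+1)^(m+1-j))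
      + lamc x m * (t:ℂ)^((m:ℤ)-1) * (((Real.exp (-t))^(k+1) / ((k:ℝ)+1) : ℝ) : ℂ)
      + (t:ℂ)^m * lamψ x m ((t*(k+1):ℝ):ℂ) := by
  have ht0 : (t:ℂ) ≠ 0 := by exact_mod_cast ht.ne'
  have hk0 : ((k:ℂ)+1) ≠ 0 := Nat.cast_add_one_ne_zero k
  set u : ℝ := t*(k+1) with hu
  have hupos : 0 < u := by positivity
  have hu0 : (u:ℂ) ≠ 0 := by exact_mod_cast hupos.ne'
  have huc : (u:ℂ) = t * (k+1) := by rw [hu]; push_cast; ring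
  have hE : lamE u ≠ 0 := lamE_ne (real_mem_lamS u) hu0
  have eq : (Real.exp (-t))^(k+1) = Real.exp (-u) := by
    rw [← Real.exp_nat_mul]; congr 1; rw [hu]; push_cast; ring
  have eq2 : (Real.exp (-t)) ^ (((k : ℝ) + 1) * x) = Real.exp (-(x*u)) := by
    rw [← Real.exp_mul]; congr 1; rw [hu]; ring
  have h1 : (((Real.exp (-t)) ^ (((k : ℝ) + 1) * x) / (((k : ℝ) + 1) ^ m * (1 - (Real.exp (-t)) ^ (k + 1))) : ℝ) : ℂ)
      = lamG x u / (u * ((k:ℂ)+1)^m) := by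
    rw [eq, eq2]
    push_cast
    have h := lamG_mul x (real_mem_lamS u)
    have h' : (1 - Complex.exp (-u)) = lamE u := rfl
    rw [h', div_eq_div_iff (by positivity) (by positivity)]
    linear_combination (-((k:ℂ)+1)^m) * h
  rw [h1, lamψ_eq x m u, eq]
  have hj : ∀ j ∈ range m, lamc x j * ((t:ℂ)^((j:ℤ)-1)) * (1 / ((k:ℂ)+1)^(m+1-j)) =
      lamc x j * (u:ℂ)^j / (u * ((k:ℂ)+1)^m) := by
    intro j hj
    have hj := Finset.mem_range.1 hj
    have e : ((k:ℂ)+1)^(m+1-j) = ((k:ℂ)+1)^(m+1) / ((k:ℂ)+1)^j := by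
      rw [eq_div_iff (pow_ne_zero _ hk0), ← pow_add]; congr 1; omega
    rw [zpow_sub₀ ht0, zpow_natCast, zpow_one, e, huc, mul_pow, pow_succ]
    field_simp
  rw [Finset.sum_congr rfl hj, ← Finset.sum_div, zpow_sub₀ ht0, zpow_natCast, zpow_one, huc]
  push_cast
  rw [huc, mul_pow, mul_pow]
  field_simp
  ring

lemma lam_hasSum (x : ℝ) (hx : 0 < x) (m : ℕ) (hm : 1 ≤ m) (t : ℝ) (ht : 0 < t) :
    (((∑' k : ℕ, (Real.exp (-t)) ^ (((k : ℝ) + 1) * x) / (((k : ℝ) + 1) ^ m * (1 - (Real.exp (-t)) ^ (k + 1)))) : ℝ) : ℂ)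
     = ∑ j ∈ range m, lamc x j * ((t:ℂ)^((j:ℤ)-1)) * riemannZeta (1 + (m:ℂ) - j)
      + lamc x m * (t:ℂ)^((m:ℤ)-1) * ((-Real.log (1 - Real.exp (-t)) : ℝ) : ℂ)
      + (t:ℂ)^m * ∑' k : ℕ, lamψ x m ((t*(k+1):ℝ):ℂ) := by
  rw [Complex.ofReal_tsum]
  refine HasSum.tsum_eq ?_
  rw [funext (lam_term x m t ht)]
  refine ((hasSum_sum fun j hj => ?_).add ?_).add ?_
  · apply HasSum.mul_left
    have hj := Finset.mem_range.1 hj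
    have := hasSum_zeta_shift (m+1-j) (by omega)
    rw [Nat.cast_sub (by omega)] at this
    push_cast at this
    rwa [add_comm (m:ℂ) 1] at this
  · apply HasSum.mul_left
    apply Complex.hasSum_ofReal.2
    exact Real.hasSum_pow_div_log_of_abs_lt_one (by rw [Real.abs_exp]; simpa using ht)
  · apply HasSum.mul_left
    obtain ⟨C, hC⟩ := lamψ_em x hx m hm 0
    exact (hC t ht).1.hasSum

lemma lam_sum_split (f : ℕ → ℂ) (m M : ℕ) : ∑ k ∈ (range (m + M + 1)).erase m, f k =
    ∑ k ∈ range m, f k + ∑ r ∈ range M, f (m + 1 + r) := by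
  have h1 := Finset.add_sum_erase (range (m+M+1)) f (a := m) (by simp)
  rw [show m + M + 1 = (m + 1) + M by ring, Finset.sum_range_add, Finset.sum_range_succ] at h1
  rw [show m + M + 1 = (m + 1) + M by ring]
  linear_combination h1

lemma lam_main (x : ℝ) (hx : 0 < x) (m : ℕ) (hm : 1 ≤ m) (M : ℕ) :
    ∃ C δ : ℝ, 0 < δ ∧ ∀ t : ℝ, 0 < t → t < δ →
    ‖(((∑' k : ℕ, (Real.exp (-t)) ^ (((k : ℝ) + 1) * x) / (((k : ℝ) + 1) ^ m * (1 - (Real.exp (-t)) ^ (k + 1)))) : ℝ) : ℂ)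
     - ((t:ℂ)^((m:ℤ)-1) * ((∫ v in Set.Ioi (0:ℝ), lamψ x m (v:ℂ)) - lamc x m * (Real.log t : ℂ))
        + ∑ k ∈ (range (m + M + 1)).erase m, riemannZeta (1 + (m:ℂ) - k) * lamc x k * (t:ℂ)^((k:ℤ)-1))‖ ≤ C * t^(m+M) := by
  obtain ⟨C1, δ, hδ, h1⟩ := lam_log M
  obtain ⟨C2, h2⟩ := lamψ_em x hx m hm M
  refine ⟨‖lamc x m‖ * C1 + C2 + ‖riemannZeta (-(M:ℂ)) * lamc x (m+1+M)‖, δ, hδ, fun t ht htd => ?_⟩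
  have ht0 : (t:ℂ) ≠ 0 := by exact_mod_cast ht.ne'
  obtain ⟨-, b2⟩ := h2 t ht
  have b1 := h1 t ht htd
  rw [lam_hasSum x hx m hm t ht, lam_sum_split]
  set I := ∫ v in Set.Ioi (0:ℝ), lamψ x m (v:ℂ)
  set S := ∑' k : ℕ, lamψ x m ((t*(k+1):ℝ):ℂ)
  set L := -Real.log ((1 - Real.exp (-t))/t) with hL
  have hlog : -Real.log (1 - Real.exp (-t)) = L - Real.log t := by
    have : Real.exp (-t) < 1 := by rw [Real.exp_lt_one_iff]; linarith
    rw [hL, Real.log_div (by linarith) ht.ne']; ring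
  have hz : (t:ℂ)^((m:ℤ)-1) = (t:ℂ)^(m-1) := by
    rw [← zpow_natCast]; congr 1; omega
  have htm : (t:ℂ)^m = (t:ℂ)^(m-1) * t := by
    rw [← pow_succ]; congr 1; omega
  set A := ∑ r ∈ range (M+1), riemannZeta (-(r:ℂ)) * ((-1)^(r+1) / (Nat.factorial (r+1) : ℂ)) * (t:ℂ)^(r+1)
    with hA
  set B := ∑ r ∈ range (M+1), riemannZeta (-(r:ℂ))*(t:ℂ)^r*(lamc x (m+1+r) + lamc x m*((-1)^r/(Nat.factorial (r+1) : ℂ)))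
    with hB
  have hAB : lamc x m * (t:ℂ)^(m-1) * A + (t:ℂ)^m * B =
      ∑ r ∈ range M, riemannZeta (1 + (m:ℂ) - ((m+1+r : ℕ) : ℂ)) * lamc x (m+1+r) * (t:ℂ)^(((m+1+r : ℕ):ℤ)-1)
      + (riemannZeta (-(M:ℂ)) * lamc x (m+1+M)) * (t:ℂ)^(m+M) := by
    have e : ∀ r : ℕ, riemannZeta (1 + (m:ℂ) - ((m+1+r : ℕ) : ℂ)) * lamc x (m+1+r) * (t:ℂ)^(((m+1+r : ℕ):ℤ)-1)
      = riemannZeta (-(r:ℂ)) * lamc x (m+1+r) * (t:ℂ)^(m+r) := by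
      intro r
      have e1 : 1 + (m:ℂ) - ((m+1+r : ℕ) : ℂ) = -(r:ℂ) := by push_cast; ring
      have e2 : ((m+1+r : ℕ):ℤ)-1 = ((m+r : ℕ) : ℤ) := by push_cast; ring
      rw [e1, e2, zpow_natCast]
    simp only [e]
    rw [← Finset.sum_range_succ (fun r => riemannZeta (-(r:ℂ)) * lamc x (m+1+r) * (t:ℂ)^(m+r)), hA, hB,
      Finset.mul_sum, Finset.mul_sum, ← Finset.sum_add_distrib]
    refine Finset.sum_congr rfl fun r _ => ?_
    rw [pow_add (t:ℂ) m r, htm]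
    ring
  have hJ : ∑ j ∈ range m, lamc x j * ((t:ℂ)^((j:ℤ)-1)) * riemannZeta (1 + (m:ℂ) - j) =
      ∑ k ∈ range m, riemannZeta (1 + (m:ℂ) - k) * lamc x k * (t:ℂ)^((k:ℤ)-1) :=
    Finset.sum_congr rfl fun r _ => by ring
  rw [hlog, hJ, hz]
  push_cast
  have key : ∀ J R : ℂ, lamc x m * (t:ℂ)^(m-1) * A + (t:ℂ)^m * B = R + (riemannZeta (-(M:ℂ)) * lamc x (m+1+M)) * (t:ℂ)^(m+M) →
     J + lamc x m * (t:ℂ)^(m-1) * ((L:ℂ) - (Real.log t : ℂ)) + (t:ℂ)^m * S -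
     ((t:ℂ)^(m-1) * (I - lamc x m * (Real.log t : ℂ)) + (J + R)) =
     lamc x m * (t:ℂ)^(m-1) * ((L:ℂ) - A) + (t:ℂ)^m * (S - (t:ℂ)⁻¹ * I - B)
      + (riemannZeta (-(M:ℂ)) * lamc x (m+1+M)) * (t:ℂ)^(m+M) := by
    intro J R h
    have e3 : (t:ℂ)^m * (t:ℂ)⁻¹ = (t:ℂ)^(m-1) := by rw [htm]; field_simp
    linear_combination h + I * e3
  push_cast at hAB
  rw [key _ _ hAB]
  refine (norm_add₃_le).trans ?_
  rw [add_mul, add_mul]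
  have n1 : ‖lamc x m * (t:ℂ)^(m-1) * ((L:ℂ) - A)‖ ≤ ‖lamc x m‖ * C1 * t^(m+M) := by
    rw [norm_mul, norm_mul, norm_pow, Complex.norm_real, Real.norm_of_nonneg ht.le]
    calc _ ≤ ‖lamc x m‖ * t^(m-1) * (C1 * t^(M+1)) := by gcongr
      _ = ‖lamc x m‖ * C1 * (t^(m-1) * t^(M+1)) := by ring
      _ = _ := by rw [← pow_add]; congr 2; omega
  have n2 : ‖(t:ℂ)^m * (S - (t:ℂ)⁻¹ * I - B)‖ ≤ C2 * t^(m+M) := by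
    rw [norm_mul, norm_pow, Complex.norm_real, Real.norm_of_nonneg ht.le]
    calc _ ≤ t^m * (C2 * t^M) := by gcongr
      _ = _ := by rw [pow_add]; ring
  have n3 : ‖(riemannZeta (-(M:ℂ)) * lamc x (m+1+M)) * (t:ℂ)^(m+M)‖ ≤ ‖riemannZeta (-(M:ℂ)) * lamc x (m+1+M)‖ * t^(m+M) := by
    rw [norm_mul _ ((t:ℂ)^(m+M)), norm_pow, Complex.norm_real, Real.norm_of_nonneg ht.le]
  exact add_le_add (add_le_add n1 n2) n3

lemma aeval_bern (x : ℝ) (k : ℕ) : (Polynomial.aeval x (Polynomial.bernoulli k) : ℝ) = bernoulliFun k x := by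
  rw [bernoulliFun, Polynomial.eval_map_algebraMap]

/-- Asymptotic expansion of the Lambert series `𝓛_q(-m,x)` near `q = 1`
for a positive integer `m`, involving the derivative of the Hurwitz zeta function in its
first argument and the harmonic number `H_{m-1}`. -/
theorem lambert_neg_int_asymptotic (m : ℕ) (hm : 1 ≤ m)
    (x : ℝ) (hx0 : 0 < x) (hx1 : x ≤ 1) (N : ℕ) (hN : m ≤ N) :
    (fun q : ℝ =>
        (((∑' k : ℕ, q ^ (((k : ℝ) + 1) * x) / (((k : ℝ) + 1) ^ m * (1 - q ^ (k + 1)))) : ℝ) : ℂ)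
        - (((m : ℂ) * deriv (fun s : ℂ => HurwitzZeta.hurwitzZeta (x : UnitAddCircle) s)
                (1 - (m : ℂ))
              + (((Real.log (Real.log (1 / q)) : ℝ) : ℂ) - ((harmonic (m - 1) : ℚ) : ℂ)) *
                  ((Polynomial.aeval x (Polynomial.bernoulli m) : ℝ) : ℂ)) *
              ((Real.log q : ℂ)) ^ (m - 1) / (Nat.factorial m : ℂ)
            - ∑ k ∈ (Finset.range (N + 1)).erase m,
                riemannZeta (1 + (m : ℂ) - (k : ℂ)) / (Nat.factorial k : ℂ) *
                  ((Polynomial.aeval x (Polynomial.bernoulli k) : ℝ) : ℂ) *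
                  ((Real.log q : ℂ)) ^ ((k : ℤ) - 1)))
      =O[𝓝[Set.Ioo (0 : ℝ) 1] 1] fun q : ℝ => (Real.log (1 / q)) ^ N := by
  obtain ⟨M, rfl⟩ : ∃ M, N = m + M := ⟨N - m, by omega⟩
  obtain ⟨C, δ, hδ, h⟩ := lam_main x hx0 m hm M
  apply IsBigO.of_bound C
  have hlog : ∀ᶠ q : ℝ in 𝓝[Set.Ioo (0 : ℝ) 1] 1, -Real.log q < δ := by
    have hc : ContinuousAt (fun q : ℝ => -Real.log q) 1 := (Real.continuousAt_log one_ne_zero).neg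
    exact nhdsWithin_le_nhds (hc.eventually_lt continuousAt_const (by simpa using hδ))
  filter_upwards [hlog, self_mem_nhdsWithin] with q hq1 hq2
  obtain ⟨t, rfl⟩ : ∃ t, q = Real.exp (-t) := ⟨-Real.log q, by rw [neg_neg, Real.exp_log hq2.1]⟩
  have ht : 0 < t := by
    have := hq2.2
    rw [Real.exp_lt_one_iff] at this
    linarith
  rw [Real.log_exp, neg_neg] at hq1
  have hb := h t ht hq1
  have ht0 : (t:ℂ) ≠ 0 := by exact_mod_cast ht.ne'
  have e1 : Real.log (1 / Real.exp (-t)) = t := by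
    rw [one_div, Real.log_inv, Real.log_exp, neg_neg]
  rw [e1, Real.log_exp, norm_pow, Real.norm_of_nonneg ht.le, hz_deriv x hx0 hx1 m hm]
  simp only [aeval_bern]
  refine le_trans (le_of_eq ?_) hb
  congr 1
  congr 1
  have hsum : ∑ k ∈ (Finset.range (m + M + 1)).erase m, riemannZeta (1 + (m : ℂ) - (k : ℂ)) / (Nat.factorial k : ℂ) *
                  ((bernoulliFun k x : ℝ) : ℂ) * (((-t : ℝ) : ℂ)) ^ ((k : ℤ) - 1)
      = - ∑ k ∈ (range (m + M + 1)).erase m, riemannZeta (1 + (m:ℂ) - k) * lamc x k * (t:ℂ)^((k:ℤ)-1) := by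
    rw [← Finset.sum_neg_distrib]
    refine Finset.sum_congr rfl fun k _ => ?_
    have h1 : (((-t : ℝ) : ℂ)) ^ ((k : ℤ) - 1) = -((-1)^k * (t:ℂ)^((k:ℤ)-1)) := by
      rw [Complex.ofReal_neg, neg_eq_neg_one_mul, mul_zpow, zpow_sub₀ (by norm_num), zpow_natCast, zpow_one]
      ring
    rw [h1, lamc]
    ring
  rw [hsum, sub_neg_eq_add]
  congr 1
  obtain ⟨n, rfl⟩ : ∃ n, m = n + 1 := ⟨m-1, by omega⟩
  have hz : (t:ℂ)^(((n+1:ℕ):ℤ)-1) = (t:ℂ)^n := by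
    rw [← zpow_natCast]; congr 1; push_cast; ring
  rw [hz, Nat.add_sub_cancel, Complex.ofReal_neg, neg_pow (t:ℂ) n]
  have hf : (n.factorial : ℂ) ≠ 0 := by exact_mod_cast n.factorial_ne_zero
  have hn1 : ((n:ℂ)+1) ≠ 0 := Nat.cast_add_one_ne_zero n
  have hsq : ((-1:ℂ)^n)*((-1:ℂ)^n) = 1 := by rw [← mul_pow]; norm_num
  generalize (∫ v in Set.Ioi (0:ℝ), lamψ x (n+1) (v:ℂ)) = I
  rw [lamc, Nat.factorial_succ, pow_succ (-1:ℂ) n]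
  generalize (-1:ℂ)^n = e at hsq ⊢
  push_cast
  field_simp
  have hsq2 : e^2 = 1 := by rw [pow_two]; exact hsq
  ring_nf
  simp only [hsq2, show e^3 = e by rw [pow_succ, hsq2, one_mul]]
  ring_nf
end

section
/- Fix an odd positive integer m. Then, as q → 1⁻ (with q ∈ (0,1)), the difference ∑_{n=1}^∞ σ_m(n)·qⁿ − [ m!·ζ(1+m)/(log q)^(1+m) − ζ(1−m)/log q − ζ(−m)/2 ] tends to 0. -/
open Filter Topology Finset Real

/-- The divisor generating function. -/
noncomputable def divF (m : ℕ) (q : ℝ) : ℝ :=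
  ∑' n : ℕ, (∑ d ∈ Nat.divisors (n + 1), (d : ℝ) ^ m) * q ^ (n + 1)

/-- The point `i t / (2 π)` of the upper half plane. -/
noncomputable def ptH (t : ℝ) (ht : 0 < t) : UpperHalfPlane :=
  UpperHalfPlane.mk (Complex.I * (t / (2 * π) : ℝ)) (by
    rw [Complex.I_mul_im, Complex.ofReal_re]; positivity)

lemma ptH_coe (t : ℝ) (ht : 0 < t) : ((ptH t ht : UpperHalfPlane) : ℂ) = Complex.I * t / (2 * π) := by
  simp [ptH, mul_div_assoc]

lemma ptH_S (t : ℝ) (ht : 0 < t) (h2 : 0 < 4 * π ^ 2 / t) :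
    ModularGroup.S • ptH t ht = ptH (4 * π ^ 2 / t) h2 := by
  rw [UpperHalfPlane.modular_S_smul]
  ext
  rw [UpperHalfPlane.coe_mk, ptH_coe, ptH_coe]
  have h1 : (π : ℂ) ≠ 0 := by exact_mod_cast Real.pi_ne_zero
  have h3 : (t : ℂ) ≠ 0 := by exact_mod_cast ht.ne'
  push_cast
  field_simp
  rw [Complex.I_sq]
  ring

lemma cexp_ptH (t : ℝ) (ht : 0 < t) :
    Complex.exp (2 * π * Complex.I * (ptH t ht : ℂ)) = ((Real.exp (-t) : ℝ) : ℂ) := by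
  rw [ptH_coe, Complex.ofReal_exp]
  congr 1
  have h1 : (π : ℂ) ≠ 0 := by exact_mod_cast Real.pi_ne_zero
  push_cast
  field_simp
  rw [Complex.I_sq]
  ring

lemma divF_eq (m : ℕ) (t : ℝ) (ht : 0 < t) :
    ((divF m (Real.exp (-t)) : ℝ) : ℂ) = ∑' n : ℕ+, (ArithmeticFunction.sigma m n : ℂ) *
      Complex.exp (2 * π * Complex.I * (ptH t ht : ℂ)) ^ (n : ℕ) := by
  rw [cexp_ptH, tsum_pnat_eq_tsum_succ (f := fun n ↦ (ArithmeticFunction.sigma m n : ℂ) *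
    ((Real.exp (-t) : ℝ) : ℂ) ^ n), divF, Complex.ofReal_tsum]
  congr 1
  ext n
  rw [ArithmeticFunction.sigma_apply]
  push_cast
  rfl

lemma summable_divF (m : ℕ) (t : ℝ) (ht : 0 < t) :
    Summable fun n : ℕ => (∑ d ∈ Nat.divisors (n + 1), (d : ℝ) ^ m) * Real.exp (-t) ^ (n + 1) := by
  have h := (summable_nat_add_iff 1).mpr
    (EisensteinSeries.summable_sigma_mul_cexp_pow (k := m + 1) (by omega) (ptH t ht))
  rw [cexp_ptH] at h
  rw [← Complex.summable_ofReal]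
  refine h.congr fun n => ?_
  rw [ArithmeticFunction.sigma_apply]
  push_cast
  rfl

lemma divF_nonneg (m : ℕ) (t : ℝ) : 0 ≤ divF m (Real.exp (-t)) :=
  tsum_nonneg fun n => by positivity

lemma divF_le (m : ℕ) (s : ℝ) (hs : 1 ≤ s) :
    divF m (Real.exp (-s)) ≤ Real.exp 1 * divF m (Real.exp (-1)) * Real.exp (-s) := by
  have : Real.exp 1 * divF m (Real.exp (-1)) * Real.exp (-s) =
      ∑' n : ℕ, Real.exp (1 - s) * ((∑ d ∈ Nat.divisors (n + 1), (d : ℝ) ^ m) *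
        Real.exp (-1) ^ (n + 1)) := by
    rw [tsum_mul_left, divF, sub_eq_add_neg, Real.exp_add]; ring
  rw [this]
  refine Summable.tsum_le_tsum (fun n => ?_) (summable_divF m s (by linarith))
    ((summable_divF m 1 one_pos).mul_left _)
  rw [mul_left_comm]
  gcongr
  rw [← Real.exp_nat_mul, ← Real.exp_nat_mul, ← Real.exp_add]
  gcongr
  push_cast
  have : (0 : ℝ) ≤ n := n.cast_nonneg
  nlinarith

lemma tendsto_divF (m k : ℕ) :
    Tendsto (fun s : ℝ => s ^ k * divF m (Real.exp (-s))) atTop (𝓝 0) := by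
  have h := (Real.tendsto_pow_mul_exp_neg_atTop_nhds_zero k).const_mul
    (Real.exp 1 * divF m (Real.exp (-1)))
  rw [mul_zero] at h
  refine squeeze_zero' ?_ ?_ h
  · filter_upwards [eventually_ge_atTop 1] with s hs
    exact mul_nonneg (by positivity) (divF_nonneg m s)
  · filter_upwards [eventually_ge_atTop 1] with s hs
    have := mul_le_mul_of_nonneg_left (divF_le m s hs) (show 0 ≤ s ^ k by positivity)
    linarith

lemma zeta_neg (j : ℕ) : riemannZeta (-((2 * j + 1 : ℕ) : ℂ)) =
    2 * (-1) ^ (j + 1) * (2 * j + 1).factorial * riemannZeta ((2 * j + 2 : ℕ) : ℂ) /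
      (2 * π) ^ (2 * j + 2) := by
  have h := riemannZeta_one_sub (s := ((2 * j + 2 : ℕ) : ℂ)) (fun n h => by
    have : ((2 * j + 2 + n : ℕ) : ℂ) = 0 := by push_cast at h ⊢; rw [h]; ring
    rw [Nat.cast_eq_zero] at this; omega) (by
    intro h
    have : (2 * j + 2 : ℕ) = 1 := by exact_mod_cast h
    omega)
  rw [show (1 : ℂ) - ((2 * j + 2 : ℕ) : ℂ) = -((2 * j + 1 : ℕ) : ℂ) by push_cast; ring] at h
  rw [h, Complex.cpow_neg, Complex.cpow_natCast,
    show ((2 * j + 2 : ℕ) : ℂ) = ((2 * j + 1 : ℕ) : ℂ) + 1 by push_cast; ring,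
    Complex.Gamma_nat_eq_factorial]
  have hc : Complex.cos (π * (((2 * j + 1 : ℕ) : ℂ) + 1) / 2) = (-1) ^ (j + 1) := by
    rw [show (π * (((2 * j + 1 : ℕ) : ℂ) + 1) / 2 : ℂ) = (((j + 1 : ℕ) * π : ℝ) : ℂ) by
      push_cast; ring, ← Complex.ofReal_cos, Real.cos_nat_mul_pi]
    simp
  rw [hc]
  ring

lemma feq_E (j : ℕ) (hj : 1 ≤ j) (t : ℝ) (ht : 0 < t) :
    ((divF (2 * j + 1) (Real.exp (-t)) : ℝ) : ℂ) =
      (2 * j + 1).factorial * riemannZeta ((2 * j + 2 : ℕ) : ℂ) / t ^ (2 * j + 2)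
      - riemannZeta (-((2 * j + 1 : ℕ) : ℂ)) / 2
      + (-1) ^ (j + 1) * (2 * π / t) ^ (2 * j + 2) *
        ((divF (2 * j + 1) (Real.exp (-(4 * π ^ 2 / t))) : ℝ) : ℂ) := by
  have h2 : 0 < 4 * π ^ 2 / t := by positivity
  have hk : 3 ≤ 2 * j + 2 := by omega
  have he : Even (2 * j + 2) := ⟨j + 1, by ring⟩
  have e1 := EisensteinSeries.q_expansion_riemannZeta hk he (ptH t ht)
  have e2 := EisensteinSeries.q_expansion_riemannZeta hk he (ptH (4 * π ^ 2 / t) h2)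
  simp only [zpow_natCast, show 2 * j + 2 - 1 = 2 * j + 1 by omega] at e1 e2
  rw [← divF_eq] at e1 e2
  have hS : ModularForm.E hk (ModularGroup.S • ptH t ht) =
      (ptH t ht : ℂ) ^ (2 * j + 2) * ModularForm.E hk (ptH t ht) := by
    have := SlashInvariantForm.slash_action_eqn''
      (Γ := MonoidHom.range (Matrix.SpecialLinearGroup.mapGL (n := Fin 2) (R := ℤ) ℝ))
      (ModularForm.E hk)
      (γ := (ModularGroup.S : Matrix.GeneralLinearGroup (Fin 2) ℝ)) ⟨ModularGroup.S, rfl⟩ (ptH t ht)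
    rw [ModularGroup.denom_S, zpow_natCast] at this
    exact this
  rw [ptH_S t ht h2, e1, e2, ptH_coe] at hS
  have h1 : (π : ℂ) ≠ 0 := by exact_mod_cast Real.pi_ne_zero
  have h3 : (t : ℂ) ≠ 0 := by exact_mod_cast ht.ne'
  have hz : riemannZeta ((2 * j + 2 : ℕ) : ℂ) ≠ 0 :=
    riemannZeta_ne_zero_of_one_lt_re <| by rw [Complex.natCast_re]; norm_cast; omega
  have hf : ((2 * j + 1).factorial : ℂ) ≠ 0 := by exact_mod_cast Nat.factorial_ne_zero _
  have hI : Complex.I ^ (2 * j + 2) = (-1) ^ (j + 1) := by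
    rw [show 2 * j + 2 = 2 * (j + 1) by ring, pow_mul, Complex.I_sq]
  have hI2 : (-2 * π * Complex.I) ^ (2 * j + 2) = (-1) ^ (j + 1) * (2 * π : ℂ) ^ (2 * j + 2) := by
    rw [mul_pow, hI, neg_mul, he.neg_pow]; ring
  rw [zeta_neg]
  rw [hI2, div_pow, mul_pow Complex.I, hI] at hS
  rw [div_pow]
  have hA : ((-1 : ℂ) ^ (j + 1)) * (-1) ^ (j + 1) = 1 := by
    rw [← mul_pow]; simp
  have hP : (2 * π : ℂ) ^ (2 * j + 2) ≠ 0 := pow_ne_zero _ (by simp [h1])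
  have hT : (t : ℂ) ^ (2 * j + 2) ≠ 0 := pow_ne_zero _ h3
  generalize (2 * π : ℂ) ^ (2 * j + 2) = P at *
  generalize (t : ℂ) ^ (2 * j + 2) = T at *
  generalize (-1 : ℂ) ^ (j + 1) = A at *
  generalize riemannZeta ((2 * j + 2 : ℕ) : ℂ) = Z at *
  generalize ((2 * j + 1).factorial : ℂ) = f at *
  generalize ((divF (2 * j + 1) (Real.exp (-(4 * π ^ 2 / t))) : ℝ) : ℂ) = X at *
  generalize ((divF (2 * j + 1) (Real.exp (-t)) : ℝ) : ℂ) = Y at *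
  have hA0 : A ≠ 0 := left_ne_zero_of_mul_eq_one hA
  have h4 : Z * f / T * A * P * (1 + Z⁻¹ * (A * P) / f * X) =
    Z * f / T * A * P * (A * T / P * (1 + Z⁻¹ * (A * P) / f * Y)) := by rw [hS]
  field_simp at h4 ⊢
  linear_combination -h4 - T * P * Y * hA

lemma feq_two (t : ℝ) (ht : 0 < t) :
    ((divF 1 (Real.exp (-t)) : ℝ) : ℂ) =
      riemannZeta 2 / t ^ 2 + riemannZeta 0 / t - riemannZeta (-1) / 2
      - (2 * π / t) ^ 2 *
        ((divF 1 (Real.exp (-(4 * π ^ 2 / t))) : ℝ) : ℂ) := by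
  have h2 : 0 < 4 * π ^ 2 / t := by positivity
  have h := EisensteinSeries.G2_S_transform (ptH t ht)
  rw [ptH_S t ht h2, EisensteinSeries.G2_eq_tsum_cexp, EisensteinSeries.G2_eq_tsum_cexp] at h
  have d1 := divF_eq 1 t ht
  have d2 := divF_eq 1 _ h2
  rw [← d1, ← d2, ptH_coe] at h
  have hz := zeta_neg 0
  norm_num at hz
  rw [hz, riemannZeta_zero]
  have h1 : (π : ℂ) ≠ 0 := by exact_mod_cast Real.pi_ne_zero
  have h3 : (t : ℂ) ≠ 0 := by exact_mod_cast ht.ne'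
  generalize ((divF 1 (Real.exp (-(4 * π ^ 2 / t))) : ℝ) : ℂ) = X at *
  generalize ((divF 1 (Real.exp (-t)) : ℝ) : ℂ) = Y at *
  generalize riemannZeta 2 = Z at *
  field_simp at h ⊢
  rw [Complex.I_sq] at h
  linear_combination h / 2

/-- For an odd positive integer `m`, the generating function of the
divisor function `σ_m` satisfies
`∑_{n≥1} σ_m(n) qⁿ − [m!·ζ(1+m)/(log q)^(1+m) − ζ(1−m)/log q − ζ(−m)/2] → 0` as `q → 1⁻`. -/
theorem divisor_gen_fun_asymptotic (m : ℕ) (hm : 1 ≤ m) (hodd : Odd m) :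
    Tendsto (fun q : ℝ =>
        (((∑' n : ℕ, (∑ d ∈ Nat.divisors (n + 1), (d : ℝ) ^ m) * q ^ (n + 1)) : ℝ) : ℂ)
        - ((Nat.factorial m : ℂ) * riemannZeta (1 + (m : ℂ)) / ((Real.log q : ℂ)) ^ (1 + m)
            - riemannZeta (1 - (m : ℂ)) / ((Real.log q : ℂ))
            - riemannZeta (-(m : ℂ)) / 2))
      (𝓝[Set.Ioo (0 : ℝ) 1] 1) (𝓝 0) := by
  obtain ⟨j, rfl⟩ := hodd
  have hlog : Tendsto (fun q : ℝ => 4 * π ^ 2 / (-Real.log q)) (𝓝[Set.Ioo (0 : ℝ) 1] 1) atTop := by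
    refine Tendsto.const_mul_atTop (r := 4 * π ^ 2) (by positivity) ?_
    refine tendsto_inv_nhdsGT_zero.comp ?_
    rw [tendsto_nhdsWithin_iff]
    constructor
    · have : Tendsto (fun q : ℝ => -Real.log q) (𝓝 1) (𝓝 (-Real.log 1)) :=
        (Real.continuousAt_log one_ne_zero).neg.tendsto
      rw [Real.log_one, neg_zero] at this
      exact this.mono_left nhdsWithin_le_nhds
    · filter_upwards [self_mem_nhdsWithin] with q hq
      simpa using Real.log_neg hq.1 hq.2
  have hlim := (tendsto_divF (2 * j + 1) (2 * j + 2)).comp hlog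
  have hlim2 := (Complex.continuous_ofReal.tendsto 0).comp hlim
  have hlim3 := hlim2.const_mul ((-1) ^ (j + 1) * ((2 * π : ℂ) ^ (2 * j + 2))⁻¹)
  rw [Complex.ofReal_zero, mul_zero] at hlim3
  refine hlim3.congr' ?_
  filter_upwards [self_mem_nhdsWithin] with q hq
  have ht : 0 < -Real.log q := by have := Real.log_neg hq.1 hq.2; linarith
  have hq' : Real.exp (-(-Real.log q)) = q := by rw [neg_neg, Real.exp_log hq.1]
  have key : ((divF (2 * j + 1) q : ℝ) : ℂ) =
      (2 * j + 1).factorial * riemannZeta ((2 * j + 2 : ℕ) : ℂ) /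
        ((-Real.log q : ℝ) : ℂ) ^ (2 * j + 2)
      + riemannZeta (1 - ((2 * j + 1 : ℕ) : ℂ)) / ((-Real.log q : ℝ) : ℂ)
      - riemannZeta (-((2 * j + 1 : ℕ) : ℂ)) / 2
      + (-1) ^ (j + 1) * (2 * π / ((-Real.log q : ℝ) : ℂ)) ^ (2 * j + 2) *
        ((divF (2 * j + 1) (Real.exp (-(4 * π ^ 2 / (-Real.log q)))) : ℝ) : ℂ) := by
    rcases Nat.eq_zero_or_pos j with rfl | hj
    · have := feq_two _ ht
      rw [hq'] at this
      simp only [mul_zero, zero_add, Nat.cast_one, Nat.factorial_one, sub_self, pow_one, one_mul,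
        Nat.cast_ofNat]
      rw [this]
      ring
    · have := feq_E j hj _ ht
      rw [hq'] at this
      have hz : riemannZeta (1 - ((2 * j + 1 : ℕ) : ℂ)) = 0 := by
        obtain ⟨i, rfl⟩ := Nat.exists_eq_add_of_le' hj
        rw [← riemannZeta_neg_two_mul_nat_add_one i]
        congr 1
        push_cast; ring
      rw [this, hz]
      ring
  change _ = ((divF (2 * j + 1) q : ℝ) : ℂ) - _
  rw [key]
  have h1 : (π : ℂ) ≠ 0 := by exact_mod_cast Real.pi_ne_zero
  have h3 : (Real.log q : ℂ) ≠ 0 := by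
    have : Real.log q ≠ 0 := by linarith
    exact_mod_cast this
  have he : Even (2 * j + 2) := ⟨j + 1, by ring⟩
  rw [show (1 : ℂ) + ((2 * j + 1 : ℕ) : ℂ) = ((2 * j + 2 : ℕ) : ℂ) by push_cast; ring,
    show 1 + (2 * j + 1) = 2 * j + 2 by ring]
  simp only [Function.comp_apply]
  push_cast
  rw [he.neg_pow, div_pow, div_pow, he.neg_pow, div_neg,
    show (4 * π ^ 2 : ℂ) = (2 * π) * (2 * π) by ring, mul_pow (2 * π : ℂ) (2 * π)]
  have hP : (2 * π : ℂ) ^ (2 * j + 2) ≠ 0 := pow_ne_zero _ (by simp [h1])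
  field_simp
  ring
end

section
/- Fix an odd positive integer m. Then, as q → 1⁻ (with q ∈ (0,1)), the difference ∑_{n=1}^∞ σ_{−m}(n)·qⁿ − { [ m·ζ′(1−m) + (log log(1/q) − H_{m−1})·B_m(1) ]·(log q)^(m−1)/m! − ∑_{k=0, k≠m}^{m+1} (ζ(1+m−k)/k!)·B_k(1)·(log q)^(k−1) } tends to 0. -/
open Filter Topology Finset Real

lemma aux_summable (m : ℕ) {q : ℝ} (h0 : 0 < q) (h1 : q < 1) :
    Summable (fun c : ℕ+ × ℕ+ => ((c.1 : ℕ) : ℝ) ^ (-(m : ℤ)) * q ^ (c.1 * c.2 : ℕ)) := by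
  have h := summable_prod_mul_pow (𝕜 := ℝ) 0 (r := q) (by rw [Real.norm_of_nonneg h0.le]; exact h1)
  refine Summable.of_nonneg_of_le (fun c => by positivity) (fun c => ?_) h
  simp only [pow_zero, one_mul]
  refine mul_le_of_le_one_left (by positivity) ?_
  rw [zpow_neg, zpow_natCast]
  apply inv_le_one_of_one_le₀
  apply one_le_pow₀
  exact_mod_cast c.1.2

lemma aux_F (m : ℕ) {q : ℝ} (h0 : 0 < q) (h1 : q < 1) :
    ∑' n : ℕ, (∑ d ∈ Nat.divisors (n + 1), (d : ℝ) ^ (-(m : ℤ))) * q ^ (n + 1) =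
      ∑' c : ℕ+ × ℕ+, ((c.1 : ℕ) : ℝ) ^ (-(m : ℤ)) * q ^ (c.1 * c.2 : ℕ) := by
  rw [← tsum_pnat_eq_tsum_succ
    (f := fun n => (∑ d ∈ Nat.divisors n, (d : ℝ) ^ (-(m : ℤ))) * q ^ n)]
  have hs := (sigmaAntidiagonalEquivProd.summable_iff).mpr (aux_summable m h0 h1)
  rw [← sigmaAntidiagonalEquivProd.tsum_eq]
  refine Eq.trans ?_ hs.tsum_sigma.symm
  refine tsum_congr fun n ↦ ?_
  simp only [sigmaAntidiagonalEquivProd, divisorsAntidiagonalFactors, PNat.mk_coe,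
    Equiv.coe_fn_mk, tsum_fintype, Finset.univ_eq_attach, Function.comp]
  rw [(n : ℕ).divisorsAntidiagonal.sum_attach
    (fun x : ℕ × ℕ ↦ (x.1 : ℝ) ^ (-(m : ℤ)) * q ^ (x.1 * x.2)),
    Nat.sum_divisorsAntidiagonal (fun x y ↦ (x : ℝ) ^ (-(m : ℤ)) * q ^ (x * y)), Finset.sum_mul]
  exact Finset.sum_congr rfl fun i hi ↦ by rw [Nat.mul_div_cancel' (Nat.dvd_of_mem_divisors hi)]

lemma aux_geom {x : ℝ} (h0 : 0 < x) (h1 : x < 1) : ∑' k : ℕ+, x ^ (k : ℕ) = x / (1 - x) := by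
  rw [tsum_pnat_eq_tsum_succ (f := fun n => x ^ n)]
  simp only [pow_succ]
  rw [tsum_mul_right, tsum_geometric_of_lt_one h0.le h1]
  field_simp

lemma aux_F1 (m : ℕ) {q : ℝ} (h0 : 0 < q) (h1 : q < 1) :
    HasSum (fun d : ℕ => ((d + 1 : ℕ) : ℝ) ^ (-(m : ℤ)) * (q ^ (d + 1) / (1 - q ^ (d + 1))))
      (∑' n : ℕ, (∑ d ∈ Nat.divisors (n + 1), (d : ℝ) ^ (-(m : ℤ))) * q ^ (n + 1)) := by
  have hs := aux_summable m h0 h1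
  have h2 : ∀ b : ℕ+, ∑' c : ℕ+, ((b : ℕ) : ℝ) ^ (-(m : ℤ)) * q ^ (b * c : ℕ) =
      ((b : ℕ) : ℝ) ^ (-(m : ℤ)) * (q ^ (b : ℕ) / (1 - q ^ (b : ℕ))) := by
    intro b
    rw [tsum_mul_left]
    simp only [pow_mul]
    rw [aux_geom (by positivity) (pow_lt_one₀ h0.le h1 b.ne_zero)]
  have h3 := hs.prod
  have h4 := hs.tsum_prod
  simp only [h2] at h3 h4
  rw [aux_F m h0 h1, h4]
  have := h3.hasSum
  rw [← Equiv.pnatEquivNat.symm.hasSum_iff] at this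
  exact this

lemma aux_F2 {q : ℝ} (h0 : 0 < q) (h1 : q < 1) :
    HasSum (fun d : ℕ => - Real.log (1 - q ^ (d + 1)))
      (∑' n : ℕ, (∑ d ∈ Nat.divisors (n + 1), (d : ℝ) ^ (-((1 : ℕ) : ℤ))) * q ^ (n + 1)) := by
  have hs := (aux_summable 1 h0 h1).prod_symm
  have h2 : ∀ b : ℕ+, ∑' c : ℕ+, ((c : ℕ) : ℝ) ^ (-((1 : ℕ) : ℤ)) * q ^ (c * b : ℕ) =
      - Real.log (1 - q ^ (b : ℕ)) := by
    intro b
    rw [tsum_pnat_eq_tsum_succ (f := fun c => (c : ℝ) ^ (-((1 : ℕ) : ℤ)) * q ^ (c * b : ℕ))]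
    have hb : |q ^ (b : ℕ)| < 1 := by
      rw [abs_of_pos (by positivity)]; exact pow_lt_one₀ h0.le h1 b.ne_zero
    rw [← (Real.hasSum_pow_div_log_of_abs_lt_one hb).tsum_eq]
    refine tsum_congr fun n => ?_
    rw [mul_comm (n + 1) (b : ℕ), pow_mul]
    simp [div_eq_inv_mul]
  have h3 := hs.prod
  have h4 := hs.tsum_prod
  have h5 : ∑' c : ℕ+ × ℕ+, ((c.2 : ℕ) : ℝ) ^ (-((1 : ℕ) : ℤ)) * q ^ (c.2 * c.1 : ℕ) =
      ∑' c : ℕ+ × ℕ+, ((c.1 : ℕ) : ℝ) ^ (-((1 : ℕ) : ℤ)) * q ^ (c.1 * c.2 : ℕ) :=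
    (Equiv.prodComm ℕ+ ℕ+).tsum_eq
      (fun c : ℕ+ × ℕ+ => ((c.1 : ℕ) : ℝ) ^ (-((1 : ℕ) : ℤ)) * q ^ (c.1 * c.2 : ℕ))
  simp only [Prod.swap] at h3 h4
  simp only [h2] at h3 h4
  rw [aux_F 1 h0 h1, ← h5, h4]
  have := h3.hasSum
  rw [← Equiv.pnatEquivNat.symm.hasSum_iff] at this
  exact this

lemma aux_lim : Tendsto (fun x : ℝ => 1 / (Real.exp x - 1) - 1 / x) (𝓝[>] 0) (𝓝 (-(1 / 2))) := by
  have h1 : Tendsto (fun x : ℝ => (Real.exp x - 1) / x) (𝓝[>] 0) (𝓝 1) := by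
    have := (Real.hasDerivAt_exp 0).tendsto_slope_zero_right
    simpa [div_eq_inv_mul] using this
  have h2 : Tendsto (fun x : ℝ => (Real.exp x - 1 - x - x ^ 2 / 2) / x ^ 2) (𝓝[>] 0) (𝓝 0) := by
    have := (Real.exp_sub_sum_range_succ_isLittleO_pow 2).tendsto_div_nhds_zero
    refine (this.mono_left nhdsWithin_le_nhds).congr fun x => ?_
    simp [Finset.sum_range_succ]
    ring
  have h3 := ((h2.add_const (1 / 2)).div h1 one_ne_zero).neg
  simp only [zero_add, div_one] at h3
  refine h3.congr' ?_
  filter_upwards [self_mem_nhdsWithin] with x hx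
  have hx : 0 < x := hx
  have : Real.exp x - 1 ≠ 0 := by have := Real.add_one_lt_exp hx.ne'; linarith
  simp only [Pi.div_apply]
  field_simp
  ring

lemma aux_bound {x : ℝ} (hx : 0 < x) : |1 / (Real.exp x - 1) - 1 / x| ≤ 1 := by
  have h1 := Real.add_one_lt_exp hx.ne'
  have h2 := Real.add_one_le_exp (-x)
  have h3 : 1 / (Real.exp x - 1) ≤ 1 / x := one_div_le_one_div_of_le hx (by linarith)
  have h4 : 1 / x ≤ 1 + 1 / (Real.exp x - 1) := by
    have h5 : 1 + 1 / (Real.exp x - 1) = 1 / (1 - Real.exp (-x)) := by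
      rw [Real.exp_neg]
      have : Real.exp x - 1 ≠ 0 := by linarith
      have h6 : 1 - (Real.exp x)⁻¹ ≠ 0 := by
        have := inv_lt_one_of_one_lt₀ (show 1 < Real.exp x by linarith)
        linarith
      field_simp
      ring
    rw [h5]
    apply one_div_le_one_div_of_le _ (by linarith)
    have : Real.exp (-x) < 1 := by simpa using hx
    linarith
  rw [abs_le]; constructor <;> linarith

lemma aux_P {q : ℝ} (h0 : 0 < q) (h1 : q < 1) :
    ‖∏' n : ℕ, (1 - (q : ℂ) ^ (n + 1))‖ = Real.exp (-
      (∑' n : ℕ, (∑ d ∈ Nat.divisors (n + 1), (d : ℝ) ^ (-((1 : ℕ) : ℤ))) * q ^ (n + 1))) := by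
  have h := (aux_F2 h0 h1).neg
  simp only [neg_neg] at h
  have hpos : ∀ i : ℕ, 0 < 1 - q ^ (i + 1) := fun i => by
    have := pow_lt_one₀ h0.le h1 (Nat.succ_ne_zero i)
    simp only [Nat.succ_eq_add_one] at this
    linarith
  have h2 := Real.rexp_tsum_eq_tprod hpos h.summable
  rw [h.tsum_eq] at h2
  rw [(ModularForm.multipliable_one_sub_pow (q := (q : ℂ))
    (by rw [Complex.norm_real, Real.norm_of_nonneg h0.le]; exact h1)).norm_tprod, h2]
  refine tprod_congr fun n => ?_
  rw [show (1 - (q : ℂ) ^ (n + 1)) = ((1 - q ^ (n + 1) : ℝ) : ℂ) by push_cast; rfl,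
    Complex.norm_real, Real.norm_of_nonneg (hpos n).le]

lemma aux_eta {t : ℝ} (ht : 0 < t) :
    ‖ModularForm.eta (Complex.I * (t / (2 * π) : ℝ))‖ = Real.exp (- t / 24 -
      (∑' n : ℕ, (∑ d ∈ Nat.divisors (n + 1), (d : ℝ) ^ (-((1 : ℕ) : ℤ))) *
        (Real.exp (-t)) ^ (n + 1))) := by
  have hq : Function.Periodic.qParam 1 (Complex.I * (t / (2 * π) : ℝ)) = (Real.exp (-t) : ℝ) := by
    have : (π : ℂ) ≠ 0 := by exact_mod_cast Real.pi_ne_zero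
    simp only [Function.Periodic.qParam]
    push_cast
    congr 1
    field_simp
    simp
  have hq24 : Function.Periodic.qParam 24 (Complex.I * (t / (2 * π) : ℝ)) =
      (Real.exp (-t / 24) : ℝ) := by
    have : (π : ℂ) ≠ 0 := by exact_mod_cast Real.pi_ne_zero
    simp only [Function.Periodic.qParam]
    push_cast
    congr 1
    field_simp
    simp
  rw [ModularForm.eta, norm_mul, hq24]
  simp only [ModularForm.eta_q, hq]
  rw [aux_P (Real.exp_pos _) (by simpa using ht), Complex.norm_real,
    Real.norm_of_nonneg (Real.exp_pos _).le, ← Real.exp_add]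
  rfl

lemma aux_transf {t : ℝ} (ht : 0 < t) :
    (∑' n : ℕ, (∑ d ∈ Nat.divisors (n + 1), (d : ℝ) ^ (-((1 : ℕ) : ℤ))) *
        (Real.exp (-t)) ^ (n + 1)) = π ^ 2 / (6 * t) + (Real.log t - Real.log (2 * π)) / 2 - t / 24
      + (∑' n : ℕ, (∑ d ∈ Nat.divisors (n + 1), (d : ℝ) ^ (-((1 : ℕ) : ℤ))) *
        (Real.exp (-(4 * π ^ 2 / t))) ^ (n + 1)) := by
  have hpi := Real.pi_pos
  have hz : Complex.I * (t / (2 * π) : ℝ) ∈ UpperHalfPlane.upperHalfPlaneSet := by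
    change 0 < (Complex.I * (t / (2 * π) : ℝ)).im
    rw [Complex.I_mul_im, Complex.ofReal_re]
    positivity
  have h := ModularForm.eta_comp_eq_csqrt_I_inv hz
  have h' := congrArg norm h
  have e : (-1 : ℂ) / (Complex.I * (t / (2 * π) : ℝ)) =
      Complex.I * ((4 * π ^ 2 / t) / (2 * π) : ℝ) := by
    have : (π : ℂ) ≠ 0 := by exact_mod_cast Real.pi_ne_zero
    have : (t : ℂ) ≠ 0 := by exact_mod_cast ht.ne'
    push_cast
    field_simp
    rw [Complex.I_sq]; ring
  have hsq : ∀ z : ℂ, z ≠ 0 → ‖Complex.sqrt z‖ = Real.exp (Real.log ‖z‖ / 2) := by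
    intro z hz
    rw [Complex.sqrt, Complex.cpow_def_of_ne_zero hz, Complex.norm_exp]
    congr 1
    rw [show Complex.log z * 2⁻¹ = Complex.log z * ((2⁻¹ : ℝ) : ℂ) by push_cast; rfl,
      Complex.re_mul_ofReal, Complex.log_re]
    ring
  simp only [Function.comp, Pi.smul_apply, Pi.mul_apply, smul_eq_mul] at h'
  rw [e, aux_eta (by positivity), norm_mul, norm_mul, norm_inv, aux_eta ht,
    hsq _ Complex.I_ne_zero, hsq] at h'
  · rw [norm_mul, Complex.norm_I, Complex.norm_real, Real.norm_of_nonneg (by positivity)] at h'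
    simp only [Real.log_one, zero_div, Real.exp_zero, inv_one, one_mul] at h'
    rw [← Real.exp_add] at h'
    have h2 := Real.exp_injective h'
    rw [Real.log_div ht.ne' (by positivity)] at h2
    have h3 : -(4 * π ^ 2 / t) / 24 = - (π ^ 2 / (6 * t)) := by field_simp; norm_num
    rw [h3] at h2
    linarith
  · have : (π : ℂ) ≠ 0 := by exact_mod_cast Real.pi_ne_zero
    have : (t : ℂ) ≠ 0 := by exact_mod_cast ht.ne'
    push_cast
    simp [*]

lemma aux_F_zero : Tendsto (fun q : ℝ => ∑' n : ℕ,
    (∑ d ∈ Nat.divisors (n + 1), (d : ℝ) ^ (-((1 : ℕ) : ℤ))) * q ^ (n + 1)) (𝓝[>] 0) (𝓝 0) := by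
  have h := (ModularForm.differentiableOn_tprod_one_sub_pow.differentiableAt
    (Metric.ball_mem_nhds (0 : ℂ) one_pos)).continuousAt.norm
  have h1 : Tendsto (fun q : ℝ => Real.log ‖∏' n : ℕ, (1 - (q : ℂ) ^ (n + 1))‖) (𝓝[>] 0)
      (𝓝 0) := by
    have h2 : Tendsto (fun q : ℝ => (q : ℂ)) (𝓝[>] 0) (𝓝 0) :=
      (Complex.continuous_ofReal.tendsto' 0 0 (by simp)).mono_left nhdsWithin_le_nhds
    have h3 := h.tendsto.comp h2
    simp only [zero_pow (Nat.succ_ne_zero _), sub_zero, tprod_one, norm_one] at h3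
    simpa using h3.log one_ne_zero
  have h4 := h1.neg
  rw [neg_zero] at h4
  refine h4.congr' ?_
  filter_upwards [Ioo_mem_nhdsGT (one_pos : (0 : ℝ) < 1)] with q hq
  rw [aux_P hq.1 hq.2, Real.log_exp, neg_neg]

lemma aux_log : Tendsto (fun q : ℝ => -Real.log q) (𝓝[Set.Ioo (0 : ℝ) 1] 1) (𝓝[>] 0) := by
  rw [tendsto_nhdsWithin_iff]
  constructor
  · have : Tendsto (fun q : ℝ => -Real.log q) (𝓝 1) (𝓝 0) := by
      simpa using (Real.continuousAt_log one_ne_zero).tendsto.neg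
    exact this.mono_left nhdsWithin_le_nhds
  · filter_upwards [self_mem_nhdsWithin] with q hq
    have := Real.log_neg hq.1 hq.2
    simpa using this

/-- case `m = 1` -/
lemma aux_case_one : Tendsto (fun q : ℝ => (∑' n : ℕ,
    (∑ d ∈ Nat.divisors (n + 1), (d : ℝ) ^ (-((1 : ℕ) : ℤ))) * q ^ (n + 1)) -
      (- Real.log (2 * π) / 2 + Real.log (Real.log (1 / q)) / 2 - π ^ 2 / 6 / Real.log q))
    (𝓝[Set.Ioo (0 : ℝ) 1] 1) (𝓝 0) := by
  have h : Tendsto (fun t : ℝ => - t / 24 + (∑' n : ℕ,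
      (∑ d ∈ Nat.divisors (n + 1), (d : ℝ) ^ (-((1 : ℕ) : ℤ))) *
        (Real.exp (-(4 * π ^ 2 / t))) ^ (n + 1))) (𝓝[>] 0) (𝓝 0) := by
    have h1 : Tendsto (fun t : ℝ => - t / 24) (𝓝[>] 0) (𝓝 0) := by
      have : Continuous (fun t : ℝ => - t / 24) := by fun_prop
      exact (this.tendsto' 0 0 (by simp)).mono_left nhdsWithin_le_nhds
    have h2 : Tendsto (fun t : ℝ => Real.exp (-(4 * π ^ 2 / t))) (𝓝[>] 0) (𝓝[>] 0) := by
      rw [tendsto_nhdsWithin_iff]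
      refine ⟨?_, Eventually.of_forall fun t => Real.exp_pos _⟩
      apply Real.tendsto_exp_neg_atTop_nhds_zero.comp
      exact tendsto_inv_nhdsGT_zero.const_mul_atTop (by positivity : (0 : ℝ) < 4 * π ^ 2)
    simpa using h1.add (aux_F_zero.comp h2)
  refine (h.comp aux_log).congr' ?_
  filter_upwards [self_mem_nhdsWithin] with q hq
  have hl := Real.log_neg hq.1 hq.2
  have := aux_transf (t := -Real.log q) (by linarith)
  rw [neg_neg, Real.exp_log hq.1] at this
  rw [this]
  simp only [Function.comp, one_div, Real.log_inv]
  have : π ^ 2 / (6 * -Real.log q) = - (π ^ 2 / 6 / Real.log q) := by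
    rw [div_div, mul_neg, div_neg]
  rw [this]
  ring

/-- case `m ≥ 2` -/
lemma aux_case_big (m : ℕ) (hm : 2 ≤ m) : Tendsto (fun q : ℝ => (∑' n : ℕ,
    (∑ d ∈ Nat.divisors (n + 1), (d : ℝ) ^ (-(m : ℤ))) * q ^ (n + 1)) +
      (∑' n : ℕ, 1 / (n : ℝ) ^ (m + 1)) / Real.log q + (∑' n : ℕ, 1 / (n : ℝ) ^ m) / 2)
    (𝓝[Set.Ioo (0 : ℝ) 1] 1) (𝓝 0) := by
  have hz : ∀ k : ℕ, 2 ≤ k → HasSum (fun n : ℕ => ((n + 1 : ℕ) : ℝ) ^ (-(k : ℤ)))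
      (∑' n : ℕ, 1 / (n : ℝ) ^ k) := by
    intro k hk
    have h := (Real.summable_one_div_nat_pow (p := k)).mpr (by omega)
    have h2 := (hasSum_nat_add_iff' 1).mpr h.hasSum
    simp only [Finset.range_one, Finset.sum_singleton] at h2
    rw [Nat.cast_zero, zero_pow (by omega), div_zero, sub_zero] at h2
    simpa [zpow_neg] using h2
  have h : Tendsto (fun t : ℝ => ∑' d : ℕ, ((d + 1 : ℕ) : ℝ) ^ (-(m : ℤ)) *
      (1 / (Real.exp (((d + 1 : ℕ) : ℝ) * t) - 1) - 1 / (((d + 1 : ℕ) : ℝ) * t))) (𝓝[>] 0)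
      (𝓝 (∑' d : ℕ, ((d + 1 : ℕ) : ℝ) ^ (-(m : ℤ)) * (-(1 / 2)))) := by
    refine tendsto_tsum_of_dominated_convergence (hz m hm).summable (fun d => ?_) ?_
    · refine (aux_lim.comp ?_).const_mul _
      rw [tendsto_nhdsWithin_iff]
      constructor
      · have : Continuous (fun t : ℝ => ((d + 1 : ℕ) : ℝ) * t) := by fun_prop
        exact (this.tendsto' 0 0 (by simp)).mono_left nhdsWithin_le_nhds
      · filter_upwards [self_mem_nhdsWithin] with t ht
        have : 0 < t := ht
        exact Set.mem_Ioi.mpr (by positivity)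
    · filter_upwards [self_mem_nhdsWithin] with t ht d
      have : 0 < t := ht
      rw [norm_mul, Real.norm_of_nonneg (by positivity)]
      exact mul_le_of_le_one_right (by positivity) (aux_bound (by positivity))
  rw [tsum_mul_right, (hz m hm).tsum_eq] at h
  have h2 := (h.comp aux_log).add_const ((∑' n : ℕ, 1 / (n : ℝ) ^ m) / 2)
  rw [show (∑' n : ℕ, 1 / (n : ℝ) ^ m) * (-(1 / 2)) + (∑' n : ℕ, 1 / (n : ℝ) ^ m) / 2 = 0 by ring]
    at h2
  refine h2.congr' ?_
  filter_upwards [self_mem_nhdsWithin] with q hq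
  have hl := Real.log_neg hq.1 hq.2
  congr 1
  have h3 := (aux_F1 m hq.1 hq.2).add ((hz (m + 1) (by omega)).div_const (Real.log q))
  simp only [Function.comp]
  rw [← h3.tsum_eq]
  refine tsum_congr fun d => ?_
  have e1 : Real.exp (((d + 1 : ℕ) : ℝ) * -Real.log q) = (q ^ (d + 1))⁻¹ := by
    rw [mul_neg, Real.exp_neg, ← Real.log_pow, Real.exp_log (pow_pos hq.1 _)]
  have hp : 0 < q ^ (d + 1) := pow_pos hq.1 _
  have hp1 : q ^ (d + 1) < 1 := pow_lt_one₀ hq.1.le hq.2 (by omega)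
  have e2 : 1 / ((q ^ (d + 1))⁻¹ - 1) = q ^ (d + 1) / (1 - q ^ (d + 1)) := by
    have : 1 - q ^ (d + 1) ≠ 0 := by linarith
    rw [show (q ^ (d + 1))⁻¹ - 1 = (1 - q ^ (d + 1)) / q ^ (d + 1) by field_simp, one_div_div]
  rw [e1, e2, mul_sub, sub_eq_add_neg]
  congr 1
  have hd : ((d + 1 : ℕ) : ℝ) ≠ 0 := by positivity
  have hl' := hl.ne
  simp only [zpow_neg, zpow_natCast]
  field_simp
  ring

lemma aux_logc : Tendsto (fun q : ℝ => (Real.log q : ℂ)) (𝓝[Set.Ioo (0 : ℝ) 1] 1) (𝓝 0) := by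
  have h : Tendsto (fun q : ℝ => Real.log q) (𝓝[Set.Ioo (0 : ℝ) 1] 1) (𝓝 0) := by
    have := (Real.continuousAt_log one_ne_zero).tendsto
    rw [Real.log_one] at this
    exact this.mono_left nhdsWithin_le_nhds
  simpa using h.ofReal

lemma aux_loglog : Tendsto (fun q : ℝ => ((Real.log (Real.log (1 / q)) : ℝ) : ℂ) * (Real.log q : ℂ))
    (𝓝[Set.Ioo (0 : ℝ) 1] 1) (𝓝 0) := by
  have h : Tendsto (fun x : ℝ => Real.log x * x) (𝓝[>] 0) (𝓝 0) := by
    simpa only [Real.rpow_one] using tendsto_log_mul_rpow_nhdsGT_zero zero_lt_one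
  have h2 := ((h.comp aux_log).neg).ofReal
  rw [neg_zero, Complex.ofReal_zero] at h2
  refine h2.congr fun q => ?_
  simp [Function.comp]

lemma aux_B0 : (Polynomial.aeval (1 : ℝ) (Polynomial.bernoulli 0) : ℝ) = 1 := by simp

lemma aux_B1 : (Polynomial.aeval (1 : ℝ) (Polynomial.bernoulli 1) : ℝ) = 1 / 2 := by
  simp [Polynomial.bernoulli_one]; norm_num

/-- For an odd positive integer `m`, the generating function of the
divisor function `σ_{-m}` minus its asymptotic expansion near `q = 1` tends to `0` as
`q → 1⁻`. -/
theorem divisor_gen_fun_neg_asymptotic (m : ℕ) (hm : 1 ≤ m) (hodd : Odd m) :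
    Tendsto (fun q : ℝ =>
        (((∑' n : ℕ, (∑ d ∈ Nat.divisors (n + 1), (d : ℝ) ^ (-(m : ℤ))) * q ^ (n + 1)) : ℝ) : ℂ)
        - (((m : ℂ) * deriv riemannZeta (1 - (m : ℂ))
              + (((Real.log (Real.log (1 / q)) : ℝ) : ℂ) - ((harmonic (m - 1) : ℚ) : ℂ)) *
                  ((Polynomial.aeval (1 : ℝ) (Polynomial.bernoulli m) : ℝ) : ℂ)) *
              ((Real.log q : ℂ)) ^ (m - 1) / (Nat.factorial m : ℂ)
            - ∑ k ∈ (Finset.range (m + 2)).erase m,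
                riemannZeta (1 + (m : ℂ) - (k : ℂ)) / (Nat.factorial k : ℂ) *
                  ((Polynomial.aeval (1 : ℝ) (Polynomial.bernoulli k) : ℝ) : ℂ) *
                  ((Real.log q : ℂ)) ^ ((k : ℤ) - 1)))
      (𝓝[Set.Ioo (0 : ℝ) 1] 1) (𝓝 0) := by
  rcases hm.eq_or_lt with rfl | hm2
  · have hS : (Finset.range (1 + 2)).erase 1 = {0, 2} := by decide
    have h := (aux_case_one.ofReal).add
      (aux_logc.const_mul (riemannZeta 0 / 2 *
        ((Polynomial.aeval (1 : ℝ) (Polynomial.bernoulli 2) : ℝ) : ℂ)))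
    rw [mul_zero, add_zero, Complex.ofReal_zero] at h
    refine h.congr fun q => ?_
    rw [hS, Finset.sum_pair (by decide), aux_B0, aux_B1]
    have e1 : deriv riemannZeta (1 - ((1 : ℕ) : ℂ)) = ((- Real.log (2 * π) / 2 : ℝ) : ℂ) := by
      rw [Nat.cast_one, sub_self, deriv_riemannZeta_zero]
      push_cast [Complex.ofReal_log (show (0 : ℝ) ≤ 2 * π by positivity)]
      rfl
    have e2 : riemannZeta (1 + ((1 : ℕ) : ℂ) - ((0 : ℕ) : ℂ)) = (π : ℂ) ^ 2 / 6 := by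
      rw [← riemannZeta_two]; congr 1; norm_num
    have e3 : riemannZeta (1 + ((1 : ℕ) : ℂ) - ((2 : ℕ) : ℂ)) = riemannZeta 0 := by
      congr 1; norm_num
    rw [e1, e2, e3]
    generalize (∑' n : ℕ, (∑ d ∈ Nat.divisors (n + 1), (d : ℝ) ^ (-((1 : ℕ) : ℤ))) * q ^ (n + 1))
      = F
    norm_num [zpow_neg, div_eq_mul_inv]
    ring
  · have hb := (aux_case_big m hm2).ofReal
    have hS : (Finset.range (m + 2)).erase m = insert 0 (insert 1 ((Finset.Ico 2 (m + 2)).erase m)) := by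
      ext k; simp only [Finset.mem_erase, Finset.mem_range, Finset.mem_insert, Finset.mem_Ico]; omega
    have hz : ∀ k : ℕ, 1 < k → riemannZeta k = ((∑' n : ℕ, 1 / (n : ℝ) ^ k : ℝ) : ℂ) := by
      intro k hk
      rw [zeta_nat_eq_tsum_of_gt_one hk]
      push_cast
      rfl
    have hrest : Tendsto (fun q : ℝ => ∑ k ∈ (Finset.Ico 2 (m + 2)).erase m,
                riemannZeta (1 + (m : ℂ) - (k : ℂ)) / (Nat.factorial k : ℂ) *
                  ((Polynomial.aeval (1 : ℝ) (Polynomial.bernoulli k) : ℝ) : ℂ) *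
                  ((Real.log q : ℂ)) ^ ((k : ℤ) - 1)) (𝓝[Set.Ioo (0 : ℝ) 1] 1) (𝓝 0) := by
      rw [show (0 : ℂ) = ∑ k ∈ (Finset.Ico 2 (m + 2)).erase m, 0 by simp]
      refine tendsto_finsetSum _ fun k hk => ?_
      have hk2 : 2 ≤ k := (Finset.mem_Ico.mp (Finset.mem_of_mem_erase hk)).1
      have := (aux_logc.pow (k - 1)).const_mul (riemannZeta (1 + (m : ℂ) - (k : ℂ)) /
        (Nat.factorial k : ℂ) * ((Polynomial.aeval (1 : ℝ) (Polynomial.bernoulli k) : ℝ) : ℂ))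
      rw [zero_pow (by omega), mul_zero] at this
      refine this.congr fun q => ?_
      rw [show ((k : ℤ) - 1) = ((k - 1 : ℕ) : ℤ) by omega, zpow_natCast]
    have hmain : Tendsto (fun q : ℝ => ((m : ℂ) * deriv riemannZeta (1 - (m : ℂ))
              + (((Real.log (Real.log (1 / q)) : ℝ) : ℂ) - ((harmonic (m - 1) : ℚ) : ℂ)) *
                  ((Polynomial.aeval (1 : ℝ) (Polynomial.bernoulli m) : ℝ) : ℂ)) *
              ((Real.log q : ℂ)) ^ (m - 1) / (Nat.factorial m : ℂ))
              (𝓝[Set.Ioo (0 : ℝ) 1] 1) (𝓝 0) := by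
      obtain ⟨j, rfl⟩ : ∃ j, m = j + 2 := ⟨m - 2, by omega⟩
      set B := ((Polynomial.aeval (1 : ℝ) (Polynomial.bernoulli (j + 2)) : ℝ) : ℂ)
      set A := ((j + 2 : ℕ) : ℂ) * deriv riemannZeta (1 - ((j + 2 : ℕ) : ℂ))
      set H := ((harmonic (j + 2 - 1) : ℚ) : ℂ)
      have := ((aux_loglog.mul_const B).add (aux_logc.const_mul (A - H * B))).mul
        ((aux_logc.pow j).mul_const (1 / (Nat.factorial (j + 2) : ℂ)))
      simp only [zero_mul, mul_zero, add_zero] at this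
      refine this.congr fun q => ?_
      rw [show j + 2 - 1 = j + 1 by omega]
      ring
    have h := (hb.sub hmain).add hrest
    simp only [Complex.ofReal_zero, sub_zero, add_zero] at h
    refine h.congr fun q => ?_
    rw [hS, Finset.sum_insert, Finset.sum_insert, aux_B0, aux_B1]
    · have e0 : riemannZeta (1 + (m : ℂ) - ((0 : ℕ) : ℂ)) =
          ((∑' n : ℕ, 1 / (n : ℝ) ^ (m + 1) : ℝ) : ℂ) := by
        rw [← hz (m + 1) (by omega)]; congr 1; push_cast; ring
      have e1 : riemannZeta (1 + (m : ℂ) - ((1 : ℕ) : ℂ)) =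
          ((∑' n : ℕ, 1 / (n : ℝ) ^ m : ℝ) : ℂ) := by
        rw [← hz m hm2]; congr 1; push_cast; ring
      rw [e0, e1]
      generalize (∑' n : ℕ, (∑ d ∈ Nat.divisors (n + 1), (d : ℝ) ^ (-(m : ℤ))) * q ^ (n + 1)) = F
      generalize (∑' n : ℕ, 1 / (n : ℝ) ^ m) = Z
      generalize (∑' n : ℕ, 1 / (n : ℝ) ^ (m + 1)) = Z'
      have e2 : ((Real.log q : ℂ)) ^ (((0 : ℕ) : ℤ) - 1) = ((Real.log q : ℂ))⁻¹ := by simp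
      have e3 : ((Real.log q : ℂ)) ^ (((1 : ℕ) : ℤ) - 1) = 1 := by simp
      rw [e2, e3]
      simp only [Nat.factorial]
      push_cast
      ring
    · simp
    · simp
end
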